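/- arXiv:2011.15088 — 5 statements merged into one kernel-verified Lean document; each statement's English description precedes it below -/
import Mathlib

section
/- Let n ≥ 2 and let L = SL_n(F_2) (which equals the simple group L_n(2)). A positive integer a belongs to the spectrum ω(L) if and only if, writing a = 2^k · b with b odd and k ≥ 0, there exist an integer s ≥ 0 and positive integers n_1, …, n_s such that n_1 + ⋯ + n_s + c ≤ n, where c = 0 if k = 0 and c = 2^{k−1} + 1 if k ≥ 1, and b divides lcm(2^{n_1} − 1, …, 2^{n_s} − 1) (with the empty lcm equal to 1). -/
open Polynomial

lemma exists_fin_family {α : Type*} (T : Finset α) (d : α → ℕ) :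
    ∃ (s : ℕ) (f : Fin s → ℕ), (∀ i, ∃ x ∈ T, f i = d x) ∧ (∑ i, f i = ∑ x ∈ T, d x) ∧
      (∀ x ∈ T, ∃ i, f i = d x) := by
  refine ⟨T.card, fun i => d (T.equivFin.symm i), fun i => ⟨_, (T.equivFin.symm i).2, rfl⟩, ?_, ?_⟩
  · rw [Equiv.sum_comp T.equivFin.symm (fun x : T => d x), Finset.sum_coe_sort]
  · intro x hx
    exact ⟨T.equivFin ⟨x, hx⟩, by simp⟩

lemma irred_dvd (p : (ZMod 2)[X]) (hp : Irreducible p) (hX : ¬ p ∣ X) :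
    p ∣ X ^ (2 ^ p.natDegree - 1) - 1 := by
  have : Fact (Irreducible p) := ⟨hp⟩
  have hfr : Module.finrank (ZMod 2) (AdjoinRoot p) = p.natDegree := by
    rw [(AdjoinRoot.powerBasis hp.ne_zero).finrank, AdjoinRoot.powerBasis_dim]
  have : Module.Finite (ZMod 2) (AdjoinRoot p) := (AdjoinRoot.powerBasis hp.ne_zero).finite
  have : Finite (AdjoinRoot p) := Module.finite_of_finite (ZMod 2)
  have := Fintype.ofFinite (AdjoinRoot p)
  have hc : Fintype.card (AdjoinRoot p) = 2 ^ p.natDegree := by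
    rw [Module.card_eq_pow_finrank (K := ZMod 2), hfr, ZMod.card]
  have h0 : AdjoinRoot.mk p X ≠ 0 := by rwa [Ne, AdjoinRoot.mk_eq_zero]
  rw [← AdjoinRoot.mk_eq_zero, map_sub, map_pow, map_one, ← hc,
    FiniteField.pow_card_sub_one_eq_one _ h0, sub_self]

lemma lcm_odd {α : Type*} {s : Finset α} {d : α → ℕ} (hd : ∀ p ∈ s, 0 < d p) :
    Odd (s.lcm fun p => 2 ^ d p - 1) := by
  have h1 : Odd (∏ p ∈ s, (2 ^ d p - 1)) := by
    rw [← Nat.coprime_two_left]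
    apply Nat.Coprime.prod_right
    intro p hp
    rw [Nat.coprime_two_left]
    exact Nat.Even.sub_odd Nat.one_le_two_pow (by simp [Nat.even_pow, (hd p hp).ne']) odd_one
  exact Odd.of_dvd_nat h1 (Finset.lcm_dvd fun p hp =>
    Finset.dvd_prod_of_mem (fun p => 2 ^ d p - 1) hp)

lemma forward (n : ℕ) (k b : ℕ) (hb : Odd b)
    (M : Matrix (Fin n) (Fin n) (ZMod 2)) (hM : orderOf M = 2 ^ k * b) :
      ∃ (s : ℕ) (f : Fin s → ℕ), (∀ i, 0 < f i) ∧
        (∑ i, f i) + (if k = 0 then 0 else 2 ^ (k - 1) + 1) ≤ n ∧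
        b ∣ (Finset.univ : Finset (Fin s)).lcm (fun i => 2 ^ f i - 1) := by
  classical
  set μ := minpoly (ZMod 2) M with hμ
  have hint : IsIntegral (ZMod 2) M := Algebra.IsIntegral.isIntegral M
  have hμ0 : μ ≠ 0 := minpoly.ne_zero hint
  have hapos : 0 < 2 ^ k * b := Nat.mul_pos (by positivity) hb.pos
  have hdeg : μ.natDegree ≤ n := by
    have h1 : μ ∣ M.charpoly := Matrix.minpoly_dvd_charpoly M
    have := natDegree_le_of_dvd h1 (Matrix.charpoly_monic M).ne_zero
    simpa [Matrix.charpoly_natDegree_eq_dim] using this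
  have hμa : μ ∣ X ^ (2 ^ k * b) - 1 := minpoly.dvd _ _ (by simp [← hM, pow_orderOf_eq_one])
  set F := UniqueFactorizationMonoid.normalizedFactors μ with hF
  set T := F.toFinset with hT
  have hirr : ∀ p ∈ T, Irreducible p := fun p hp =>
    UniqueFactorizationMonoid.irreducible_of_normalized_factor p (Multiset.mem_toFinset.1 hp)
  have hdvd : ∀ p ∈ T, p ∣ μ := fun p hp =>
    UniqueFactorizationMonoid.dvd_of_mem_normalizedFactors (Multiset.mem_toFinset.1 hp)
  have hpos : ∀ p ∈ T, 0 < p.natDegree := fun p hp => (hirr p hp).natDegree_pos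
  have hX : ∀ p ∈ T, ¬ p ∣ X := by
    intro p hp h
    have h1 := (hdvd p hp).trans hμa
    have h2 : p ∣ X ^ (2 ^ k * b) := dvd_pow h hapos.ne'
    have h3 : p ∣ 1 := by simpa using dvd_sub h2 h1
    exact (hirr p hp).not_isUnit (isUnit_of_dvd_one h3)
  have hass : Associated (∏ p ∈ T, p ^ F.count p) μ := by
    rw [hT, ← Finset.prod_multiset_count]
    exact UniqueFactorizationMonoid.prod_normalizedFactors hμ0
  have hsum : ∑ p ∈ T, F.count p * p.natDegree ≤ n := by
    have h1 : (∏ p ∈ T, p ^ F.count p).natDegree = μ.natDegree :=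
      natDegree_eq_of_degree_eq (degree_eq_degree_of_associated hass)
    rw [natDegree_prod _ _ (fun p hp => pow_ne_zero _ (hirr p hp).ne_zero)] at h1
    simp only [natDegree_pow] at h1
    omega
  have hcount : ∀ p ∈ T, 1 ≤ F.count p := fun p hp =>
    Multiset.one_le_count_iff_mem.2 (Multiset.mem_toFinset.1 hp)
  set L := T.lcm (fun p => 2 ^ p.natDegree - 1) with hL
  have hLodd : Odd L := lcm_odd hpos
  have hpL : ∀ p ∈ T, p ∣ X ^ L - 1 := by
    intro p hp
    refine (irred_dvd p (hirr p hp) (hX p hp)).trans ?_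
    obtain ⟨c, hc⟩ : 2 ^ p.natDegree - 1 ∣ L :=
      Finset.dvd_lcm (f := fun p : (ZMod 2)[X] => 2 ^ p.natDegree - 1) hp
    rw [hc, pow_mul]
    simpa using sub_dvd_pow_sub_pow (X ^ (2 ^ p.natDegree - 1) : (ZMod 2)[X]) 1 c
  have key : ∀ j, (∀ p ∈ T, F.count p ≤ 2 ^ j) → 2 ^ k * b ∣ 2 ^ j * L := by
    intro j hj
    rw [← hM]
    apply orderOf_dvd_of_pow_eq_one
    have h1 : μ ∣ X ^ (2 ^ j * L) - 1 := by
      refine hass.symm.dvd.trans ?_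
      apply Finset.prod_dvd_of_coprime
      · intro p hp q hq hpq
        apply IsCoprime.pow
        refine ((hirr p hp).coprime_iff_not_dvd).2 fun h => hpq ?_
        have := (hirr p hp).associated_of_dvd (hirr q hq) h
        rw [← UniqueFactorizationMonoid.normalize_normalized_factor p (Multiset.mem_toFinset.1 hp),
          ← UniqueFactorizationMonoid.normalize_normalized_factor q (Multiset.mem_toFinset.1 hq)]
        exact normalize_eq_normalize_iff_associated.2 this
      · intro p hp
        have h2 : (X ^ (2 ^ j * L) - 1 : (ZMod 2)[X]) = (X ^ L - 1) ^ (2 ^ j) := by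
          rw [sub_pow_char_pow, one_pow, ← pow_mul, mul_comm]
        rw [h2]
        exact (pow_dvd_pow p (hj p hp)).trans (pow_dvd_pow_of_dvd (hpL p hp) _)
    have := (minpoly.dvd_iff).1 h1
    simpa [sub_eq_zero] using this
  have hbL : b ∣ L := by
    obtain ⟨j, hj⟩ : ∃ j, ∀ p ∈ T, F.count p ≤ 2 ^ j :=
      ⟨Multiset.card F, fun p _ => (Multiset.count_le_card p F).trans Nat.lt_two_pow_self.le⟩
    exact (Nat.Coprime.pow_right j hb.coprime_two_right).dvd_of_dvd_mul_left
      ((Dvd.intro_left _ rfl).trans (key j hj))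
  have fin : ∀ T' ⊆ T, (∀ p ∈ T, p ∉ T' → p.natDegree = 1) →
      (∑ p ∈ T', p.natDegree) + (if k = 0 then 0 else 2 ^ (k - 1) + 1) ≤ n →
      ∃ (s : ℕ) (f : Fin s → ℕ), (∀ i, 0 < f i) ∧
        (∑ i, f i) + (if k = 0 then 0 else 2 ^ (k - 1) + 1) ≤ n ∧
        b ∣ (Finset.univ : Finset (Fin s)).lcm (fun i => 2 ^ f i - 1) := by
    intro T' hT' h1 h2
    obtain ⟨s, f, hf1, hf2, hf3⟩ := exists_fin_family T' (fun p => p.natDegree)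
    refine ⟨s, f, ?_, by rwa [hf2], hbL.trans ?_⟩
    · intro i
      obtain ⟨x, hx, h⟩ := hf1 i
      rw [h]; exact hpos x (hT' hx)
    · apply Finset.lcm_dvd
      intro p hp
      by_cases hp' : p ∈ T'
      · obtain ⟨i, hi⟩ := hf3 p hp'
        rw [← hi]
        exact Finset.dvd_lcm (f := fun i => 2 ^ f i - 1) (Finset.mem_univ i)
      · rw [h1 p hp hp']; simp
  by_cases hk : k = 0
  · refine fin T subset_rfl (fun p h h' => absurd h h') ?_
    rw [if_pos hk, add_zero]
    exact (Finset.sum_le_sum fun p hp => Nat.le_mul_of_pos_left _ (hcount p hp)).trans hsum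
  · obtain ⟨m, rfl⟩ := Nat.exists_eq_succ_of_ne_zero hk
    obtain ⟨p, hp, hpc⟩ : ∃ p ∈ T, 2 ^ m < F.count p := by
      by_contra! h
      have h1 := key m h
      rw [Nat.succ_eq_add_one, pow_succ, mul_assoc] at h1
      have h2 := Nat.dvd_of_mul_dvd_mul_left (by positivity) h1
      exact hLodd.not_two_dvd_nat ((Dvd.intro _ rfl).trans h2)
    have hle : ∑ q ∈ T.erase p, q.natDegree ≤ ∑ q ∈ T.erase p, F.count q * q.natDegree :=
      Finset.sum_le_sum fun q hq => Nat.le_mul_of_pos_left _ (hcount q (Finset.mem_of_mem_erase hq))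
    rw [← Finset.add_sum_erase _ _ hp] at hsum
    by_cases hd : p.natDegree = 1
    · refine fin (T.erase p) (Finset.erase_subset _ _) ?_ ?_
      · intro q hq hq'
        have : q = p := by by_contra h; exact hq' (Finset.mem_erase.2 ⟨h, hq⟩)
        rw [this, hd]
      · simp only [hk, if_false, Nat.succ_sub_one]
        rw [hd] at hsum
        omega
    · refine fin T subset_rfl (fun p h h' => absurd h h') ?_
      rw [← Finset.add_sum_erase _ _ hp]
      simp only [hk, if_false, Nat.succ_sub_one]
      have h2 : 2 ≤ p.natDegree := by have := hpos p hp; omega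
      have h3 : 1 ≤ 2 ^ m := Nat.one_le_two_pow
      have h4 : p.natDegree + 2 ^ m + 1 ≤ F.count p * p.natDegree := by nlinarith
      omega

lemma orderOf_unip (k : ℕ) (u : AdjoinRoot (X ^ (if k = 0 then 0 else 2 ^ (k - 1) + 1) : (ZMod 2)[X]))
    (hu : u = AdjoinRoot.mk _ (X + 1)) : orderOf u = 2 ^ k := by
  have h (j : ℕ) : u ^ 2 ^ j = 1 ↔
      (X ^ (if k = 0 then 0 else 2 ^ (k - 1) + 1) : (ZMod 2)[X]) ∣ X ^ 2 ^ j := by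
    rw [hu, ← map_pow, add_pow_char_pow, one_pow, map_add, map_one, add_eq_right,
      AdjoinRoot.mk_eq_zero]
  have h' (j : ℕ) : u ^ 2 ^ j = 1 ↔ (if k = 0 then 0 else 2 ^ (k - 1) + 1) ≤ 2 ^ j := by
    rw [h]
    exact pow_dvd_pow_iff X_ne_zero not_isUnit_X
  rcases k with _ | k
  · simpa using (h' 0)
  · apply orderOf_eq_prime_pow
    · rw [h']; simp
    · rw [h']
      have : 1 ≤ 2 ^ k := Nat.one_le_two_pow
      simp [pow_succ]

lemma orderOf_triple {s : ℕ} (f : Fin s → ℕ) (hf : ∀ i, 0 < f i) (k : ℕ)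
    {K : Fin s → Type} [∀ i, Monoid (K i)] {B C : Type} [Monoid B] [Monoid C]
    (x : ∀ i, K i) (hx : ∀ i, orderOf (x i) = 2 ^ f i - 1) (u : B) (hu : orderOf u = 2 ^ k) :
    orderOf ((x, u, 1) : (∀ i, K i) × B × C) =
      2 ^ k * Finset.univ.lcm (fun i => 2 ^ f i - 1) := by
  have hodd : Odd (Finset.univ.lcm (fun i => 2 ^ f i - 1)) := lcm_odd fun i _ => hf i
  apply Nat.dvd_antisymm
  · apply orderOf_dvd_of_pow_eq_one
    refine Prod.ext (funext fun i => ?_) (Prod.ext ?_ ?_)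
    · change x i ^ _ = 1
      rw [← orderOf_dvd_iff_pow_eq_one, hx]
      exact (Finset.dvd_lcm (f := fun i => 2 ^ f i - 1) (Finset.mem_univ i)).trans
        (Dvd.intro_left _ rfl)
    · change u ^ _ = 1
      rw [← orderOf_dvd_iff_pow_eq_one, hu]
      exact Dvd.intro _ rfl
    · exact one_pow _
  · have h := pow_orderOf_eq_one ((x, u, 1) : (∀ i, K i) × B × C)
    apply Nat.Coprime.mul_dvd_of_dvd_of_dvd (Nat.Coprime.pow_left _ hodd.coprime_two_left)
    · rw [← hu]
      exact orderOf_dvd_of_pow_eq_one (congrArg (fun z => z.2.1) h)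
    · apply Finset.lcm_dvd
      intro i _
      rw [← hx]
      exact orderOf_dvd_of_pow_eq_one (congrFun (congrArg (fun z => z.1) h) i)

lemma backward_aux (n : ℕ) {A : Type} [CommRing A] [Algebra (ZMod 2) A]
    [Module.Finite (ZMod 2) A] (hA : Module.finrank (ZMod 2) A = n) (a : A) :
    ∃ M : Matrix (Fin n) (Fin n) (ZMod 2), orderOf M = orderOf a := by
  let e := Module.finBasisOfFinrankEq (ZMod 2) A hA
  refine ⟨Algebra.leftMulMatrix e a, ?_⟩
  rw [orderOf_eq_orderOf_iff]
  intro m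
  rw [← map_pow]
  exact map_eq_one_iff _ (Algebra.leftMulMatrix_injective e)

lemma exists_gen (d : ℕ) (hd : 0 < d) : ∃ x : GaloisField 2 d, orderOf x = 2 ^ d - 1 := by
  obtain ⟨g, hg⟩ := IsCyclic.exists_ofOrder_eq_natCard (α := (GaloisField 2 d)ˣ)
  refine ⟨g, ?_⟩
  rw [orderOf_units, hg, Nat.card_units, GaloisField.card 2 _ hd.ne']

lemma finrank_triple {s : ℕ} (f : Fin s → ℕ) (hf : ∀ i, 0 < f i) (r c : ℕ)
    (B : Type) [CommRing B] [Algebra (ZMod 2) B] [Module.Finite (ZMod 2) B]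
    (hB : Module.finrank (ZMod 2) B = c) :
    Module.finrank (ZMod 2) ((∀ i, GaloisField 2 (f i)) × B × (Fin r → ZMod 2)) =
      ∑ i, f i + (c + r) := by
  have h (i : Fin s) := GaloisField.finrank 2 (hf i).ne'
  rw [Module.finrank_prod, Module.finrank_prod, Module.finrank_pi_fintype, hB,
    Module.finrank_fin_fun]
  simp only [h]

lemma backward (n : ℕ) (k b : ℕ)
    (s : ℕ) (f : Fin s → ℕ) (hf : ∀ i, 0 < f i)
    (hle : (∑ i, f i) + (if k = 0 then 0 else 2 ^ (k - 1) + 1) ≤ n)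
    (hd : b ∣ (Finset.univ : Finset (Fin s)).lcm (fun i => 2 ^ f i - 1)) :
    ∃ M : Matrix (Fin n) (Fin n) (ZMod 2), orderOf M = 2 ^ k * b := by
  obtain ⟨B, _, _, _, hB, u, hu⟩ : ∃ (B : Type) (_ : CommRing B) (_ : Algebra (ZMod 2) B)
      (_ : Module.Finite (ZMod 2) B)
      (_ : Module.finrank (ZMod 2) B = (if k = 0 then 0 else 2 ^ (k - 1) + 1)) (u : B),
      orderOf u = 2 ^ k := by
    have hP := (monic_X_pow (R := ZMod 2) (if k = 0 then 0 else 2 ^ (k - 1) + 1)).ne_zero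
    refine ⟨AdjoinRoot (X ^ (if k = 0 then 0 else 2 ^ (k - 1) + 1) : (ZMod 2)[X]),
      inferInstance, inferInstance, (AdjoinRoot.powerBasis hP).finite, ?_, _, orderOf_unip k _ rfl⟩
    rw [(AdjoinRoot.powerBasis hP).finrank, AdjoinRoot.powerBasis_dim, natDegree_X_pow]
  choose x hx using fun i => exists_gen (f i) (hf i)
  obtain ⟨r, hr⟩ := Nat.exists_eq_add_of_le hle
  have ha := orderOf_triple f hf k (C := Fin r → ZMod 2) x hx u hu
  obtain ⟨M, hM⟩ := backward_aux n ((finrank_triple f hf r _ B hB).trans (by omega))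
    ((x, u, 1) : (∀ i, GaloisField 2 (f i)) × B × (Fin r → ZMod 2))
  rw [ha] at hM
  have hL0 := (lcm_odd (s := Finset.univ) (d := f) fun i _ => hf i).pos.ne'
  obtain ⟨m, hm⟩ := hd
  have hm0 : m ≠ 0 := by rintro rfl; exact hL0 (by simpa using hm)
  rw [hm, ← mul_assoc] at hM
  refine ⟨M ^ m, ?_⟩
  rw [orderOf_pow_of_dvd hm0, hM, Nat.mul_div_cancel _ (Nat.pos_of_ne_zero hm0)]
  rw [hM]
  exact Dvd.intro_left _ rfl

theorem spectrum_of_Ln2 (n : ℕ) (hn : 2 ≤ n) (a k b : ℕ) (hb : Odd b) (ha : a = 2 ^ k * b) :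
    (∃ g : Matrix.SpecialLinearGroup (Fin n) (ZMod 2), orderOf g = a) ↔
      ∃ (s : ℕ) (f : Fin s → ℕ), (∀ i, 0 < f i) ∧
        (∑ i, f i) + (if k = 0 then 0 else 2 ^ (k - 1) + 1) ≤ n ∧
        b ∣ (Finset.univ : Finset (Fin s)).lcm (fun i => 2 ^ f i - 1) := by
  have hinj (g : Matrix.SpecialLinearGroup (Fin n) (ZMod 2)) :
      orderOf (g : Matrix (Fin n) (Fin n) (ZMod 2)) = orderOf g :=
    orderOf_injective ({ toFun := fun g => g.1, map_one' := rfl, map_mul' := fun _ _ => rfl } :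
        Matrix.SpecialLinearGroup (Fin n) (ZMod 2) →* Matrix (Fin n) (Fin n) (ZMod 2))
      Subtype.val_injective g
  constructor
  · rintro ⟨g, hg⟩
    exact forward n k b hb g.1 (by rw [hinj, hg, ha])
  · rintro ⟨s, f, hf, hle, hd⟩
    obtain ⟨M, hM⟩ := backward n k b s f hf hle hd
    have hapos : 2 ^ k * b ≠ 0 := (Nat.mul_pos (by positivity) hb.pos).ne'
    have h0 : M.det ≠ 0 := by
      intro h
      have h1 := congrArg Matrix.det (pow_orderOf_eq_one M)
      rw [Matrix.det_pow, h, Matrix.det_one, hM, zero_pow hapos] at h1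
      exact zero_ne_one h1
    have h1 : M.det = 1 := by
      generalize M.det = z at h0
      revert z; decide
    exact ⟨⟨M, h1⟩, (hinj ⟨M, h1⟩).symm.trans (hM.trans ha.symm)⟩
end

section
/- Let m > 5 and L = SL_{2^m}(F_2). Then the independence number of L equals 2^{m−1}; that is, the maximum cardinality of a finite set P of primes, each dividing |L|, such that for all distinct p, q ∈ P no element of L has order divisible by pq, is exactly 2^{m−1}. -/
open Polynomial in
theorem zs_expand {R : Type*} [CommRing R] (p d : ℕ) (hp : p.Prime) (i : ℕ) (x : R) :
    (cyclotomic (d * p * p ^ i) R).eval x = (cyclotomic (d * p) R).eval (x ^ p ^ i) := by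
  induction i generalizing x with
  | zero => simp
  | succ i ih =>
    rw [pow_succ, ← mul_assoc, ← cyclotomic_expand_eq_cyclotomic hp (Dvd.intro_left d rfl |>.mul_right _),
      expand_eval, ih, ← pow_mul, mul_comm]

theorem zs_ineq (y : ℕ) (p : ℕ) (hy : 2 ≤ y) (hp : 5 ≤ p) : p * (y + 1) < y ^ p - 1 := by
  have h1 : ∀ p, 5 ≤ p → p * (y + 1) + 1 < y ^ p := by
    intro p hp
    induction p, hp using Nat.le_induction with
    | base =>
      have : 2 ^ 4 ≤ y ^ 4 := Nat.pow_le_pow_left hy 4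
      nlinarith
    | succ n hn ih => 
      rw [pow_succ]
      nlinarith [Nat.mul_le_mul hn hy]
  have := h1 p hp
  omega

theorem zs_ineq3 (y : ℕ) (hy : 3 ≤ y) : 3 * (y + 1) < y ^ 3 - 1 := by
  have : 3 * (y + 1) + 1 < y ^ 3 := by
    have : 3 ^ 2 ≤ y ^ 2 := Nat.pow_le_pow_left hy 2
    nlinarith
  omega

open Polynomial in
theorem zs_size (p d j k : ℕ) (hp : p.Prime) (hp2 : p ≠ 2) (hpd : ¬ p ∣ d) (hd : d ∣ p - 1)
    (hk : k = p ^ (j + 1) * d) (h7 : 7 ≤ k) : (cyclotomic k ℤ).eval 2 ≠ p := by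
  intro h
  set y : ℕ := 2 ^ p ^ j with hy
  have hR : (cyclotomic k ℝ).eval 2 = p := by
    have := cyclotomic.eval_apply (2:ℤ) k (Int.castRingHom ℝ)
    rw [h] at this
    simpa using this
  have hk' : k = d * p * p ^ j := by rw [hk]; ring
  rw [hk', zs_expand p d hp] at hR
  have hexp := congrArg (eval ((y:ℝ))) (cyclotomic_expand_eq_cyclotomic_mul hp hpd ℝ)
  rw [expand_eval, eval_mul] at hexp
  have hyc : (2:ℝ) ^ p ^ j = (y:ℝ) := by rw [hy]; push_cast; rfl
  rw [hyc] at hR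
  rw [hR] at hexp
  have hy2 : 2 ≤ y := by
    calc 2 = 2 ^ 1 := rfl
      _ ≤ _ := Nat.pow_le_pow_right (by norm_num) (Nat.pos_of_ne_zero (pow_ne_zero _ hp.ne_zero))
  have hyR : (1:ℝ) < y := by exact_mod_cast hy2
  have hypR : (1:ℝ) < (y:ℝ)^p := one_lt_pow₀ hyR hp.ne_zero
  have hlow := sub_one_pow_totient_le_cyclotomic_eval hypR d
  have hup := cyclotomic_eval_le_add_one_pow_totient hyR d
  have hmain : p * (y + 1) < y ^ p - 1 := by
    have := hp.two_le
    rcases Nat.lt_or_ge p 5 with h5 | h5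
    · have h3 : p = 3 := by
        interval_cases p <;> first | rfl | omega | (revert hp; decide)
      subst h3
      apply zs_ineq3
      have hd2 : d ≤ 2 := Nat.le_of_dvd (by norm_num) hd
      have : j ≠ 0 := by
        rintro rfl
        have : k ≤ 6 := by rw [hk]; omega
        omega
      have h3j : 3 ≤ 3 ^ j := Nat.le_self_pow this 3
      have : 2 ^ 3 ≤ y := Nat.pow_le_pow_right (by norm_num) h3j
      omega
    · exact zs_ineq y p hy2 h5
  have hmainR : (p:ℝ) * (y + 1) < (y:ℝ) ^ p - 1 := by
    have : p * (y + 1) + 1 < y ^ p := by omega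
    have : ((p * (y + 1) + 1 : ℕ):ℝ) < ((y ^ p : ℕ) : ℝ) := by exact_mod_cast this
    push_cast at this
    linarith
  have hd0 : d ≠ 0 := by rintro rfl; simp at hpd
  have hphi : Nat.totient d ≠ 0 := (Nat.totient_pos.2 (Nat.pos_of_ne_zero hd0)).ne'
  have hp1 : (1:ℝ) ≤ p := by exact_mod_cast hp.one_le
  have h1 := pow_lt_pow_left₀ hmainR (by positivity) hphi
  rw [mul_pow] at h1
  have h2 : (p:ℝ) ≤ (p:ℝ) ^ Nat.totient d := le_self_pow₀ hp1 hphi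
  have h3 : (0:ℝ) < (y + 1 : ℝ) ^ Nat.totient d := by positivity
  nlinarith [mul_le_mul_of_nonneg_right h2 h3.le, mul_le_mul_of_nonneg_left hup (by positivity : (0:ℝ) ≤ p)]

open Polynomial in
theorem zs_sq (p k : ℕ) (hp : p.Prime) (hp2 : p ≠ 2) (hk : k ≠ 0) (hpk : p ∣ k)
    (h1 : (2 : ZMod p) ^ (k / p) = 1) : ¬ ((p:ℤ)^2 ∣ (cyclotomic k ℤ).eval 2) := by
  intro h
  obtain ⟨c, rfl⟩ := hpk
  have hc : c ≠ 0 := by rintro rfl; simp at hk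
  rw [Nat.mul_div_cancel_left _ hp.pos] at h1
  have hb : (p:ℤ) ∣ 2 ^ c - 1 := by
    rw [← ZMod.intCast_zmod_eq_zero_iff_dvd]
    push_cast
    rw [h1, sub_self]
  obtain ⟨b, hb⟩ := hb
  have hx : (2:ℤ) ^ c = 1 + p * b := by linarith
  have hodd : Odd p := hp.odd_of_ne_two hp2
  have hd := odd_sq_dvd_geom_sum₂_sub (R := ℤ) 1 b hodd
  have hcy := X_pow_sub_one_mul_cyclotomic_dvd_X_pow_sub_one_of_dvd ℤ (d := c) (n := p * c)
    (by rw [Nat.mem_properDivisors]; exact ⟨Dvd.intro_left p rfl, by nlinarith [hp.two_le, Nat.pos_of_ne_zero hc]⟩)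
  have hcy2 := map_dvd (evalRingHom (2:ℤ)) hcy
  simp only [coe_evalRingHom, eval_mul, eval_sub, eval_pow, eval_X, eval_one] at hcy2
  rw [mul_comm p c, pow_mul, ← mul_geom_sum ((2:ℤ) ^ c) p] at hcy2
  have hne : (2:ℤ)^c - 1 ≠ 0 := by
    have : (1:ℤ) < 2 ^ c := one_lt_pow₀ (by norm_num) hc
    omega
  have h3 := (mul_dvd_mul_iff_left hne).1 hcy2
  rw [mul_comm p c] at h
  have h4 := h.trans h3
  simp only [one_pow, mul_one] at hd
  rw [← hx] at hd
  have h5 := (dvd_sub_right h4).1 hd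
  have h6 : p ^ 2 ∣ p := by exact_mod_cast h5
  have := Nat.le_of_dvd hp.pos h6
  nlinarith [hp.two_le]

open Polynomial in
theorem zs (k : ℕ) (h7 : 7 ≤ k) : ∃ p : ℕ, p.Prime ∧ orderOf (2 : ZMod p) = k := by
  by_contra! hcon
  set N := (cyclotomic k ℤ).eval 2 with hN
  have hgt : 1 < N.natAbs := by
    have := sub_one_lt_natAbs_cyclotomic_eval (n := k) (q := 2) (by omega) (by norm_num)
    simpa using this
  have hpos : 0 < N := cyclotomic_pos (by omega) 2
  have key : ∀ p : ℕ, p.Prime → p ∣ N.natAbs → ∃ j d, k = p ^ (j+1) * d ∧ ¬ p ∣ d ∧ d ∣ p - 1 ∧ p ≠ 2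
      ∧ orderOf (2 : ZMod p) = d := by
    intro p hp hpN
    have := Fact.mk hp
    obtain ⟨j, d, hd, hk⟩ := Nat.exists_eq_pow_mul_and_not_dvd (n := k) (by omega) p hp.ne_one
    have : NeZero (d : ZMod p) := ⟨by rwa [Ne, ZMod.natCast_eq_zero_iff]⟩
    have hroot : (cyclotomic (p ^ j * d) (ZMod p)).IsRoot 2 := by
      rw [← hk, IsRoot.def]
      have := cyclotomic.eval_apply (2:ℤ) k (Int.castRingHom (ZMod p))
      rw [← hN] at this
      simp only [eq_intCast, Int.cast_ofNat] at this
      rw [this, ZMod.intCast_zmod_eq_zero_iff_dvd]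
      exact Int.natCast_dvd.2 hpN
    rw [isRoot_cyclotomic_prime_pow_mul_iff_of_charP] at hroot
    have hord := hroot.eq_orderOf
    have hp2 : p ≠ 2 := by
      rintro rfl
      have := hroot.pow_eq_one
      have h0 : d ≠ 0 := by rintro rfl; simp at hd
      rw [show (2 : ZMod 2) = 0 from rfl, zero_pow h0] at this
      exact zero_ne_one this
    have hj : j ≠ 0 := by
      rintro rfl
      apply hcon p hp
      rw [← hord, hk]; simp
    have hdp : d ∣ p - 1 := by
      rw [hord]
      apply orderOf_dvd_of_pow_eq_one
      apply ZMod.pow_card_sub_one_eq_one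
      intro h0
      have : ((2:ℕ) : ZMod p) = 0 := by exact_mod_cast h0
      rw [ZMod.natCast_eq_zero_iff] at this
      exact hp2 ((Nat.prime_dvd_prime_iff_eq hp Nat.prime_two).1 this)
    obtain ⟨j, rfl⟩ := Nat.exists_eq_succ_of_ne_zero hj
    exact ⟨j, d, hk, hd, hdp, hp2, hord.symm⟩
  have hlt : ∀ p q : ℕ, p.Prime → q.Prime → p ∣ N.natAbs → q ∣ N.natAbs → ¬ p < q := by
    intro p q hp hq hpN hqN hlt
    obtain ⟨j, d, hk, hd, hdp, _⟩ := key p hp hpN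
    obtain ⟨i, f, hk', _⟩ := key q hq hqN
    have hqk : q ∣ p ^ (j+1) * d := by
      rw [← hk, hk', pow_succ]; exact (Dvd.intro_left _ rfl).mul_right _
    rcases (Nat.Prime.dvd_mul hq).1 hqk with h | h
    · have := Nat.le_of_dvd hp.pos (hq.dvd_of_dvd_pow h)
      omega
    · have := Nat.le_of_dvd (by have := hp.two_le; omega) (h.trans hdp)
      omega
  set p := N.natAbs.minFac with hpdef
  have hp : p.Prime := Nat.minFac_prime hgt.ne'
  have hpN : p ∣ N.natAbs := Nat.minFac_dvd _
  have hpow := Nat.eq_prime_pow_of_unique_prime_dvd (n := N.natAbs) (p := p) (by omega)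
    (fun {q} hq hqN => le_antisymm (not_lt.1 (hlt p q hp hq hpN hqN)) (not_lt.1 (hlt q p hq hp hqN hpN)))
  obtain ⟨j, d, hk, hd, hdp, hp2, hord⟩ := key p hp hpN
  have hsq := zs_sq p k hp hp2 (by omega) (by rw [hk, pow_succ]; exact (Dvd.intro_left _ rfl).mul_right _)
    (by
      rw [← orderOf_dvd_iff_pow_eq_one, hord, hk, pow_succ, mul_assoc, mul_comm p, ← mul_assoc, Nat.mul_div_cancel _ hp.pos]
      exact Dvd.intro_left _ rfl)
  have hlen : N.natAbs.primeFactorsList.length < 2 := by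
    by_contra! hl
    apply hsq
    rw [← hN]
    have : p ^ 2 ∣ N.natAbs := by
      rw [hpow]; exact pow_dvd_pow _ hl
    have := Int.natCast_dvd.2 this
    exact_mod_cast this
  have hlen1 : N.natAbs = p := by
    interval_cases hh : N.natAbs.primeFactorsList.length
    · simp at hpow; omega
    · simpa using hpow
  apply zs_size p d j k hp hp2 hd hdp hk h7
  rw [← hN]
  omega

theorem g_transfer (n : ℕ) (A : Type) [Ring A] [Algebra (ZMod 2) A] [Module.Finite (ZMod 2) A]
    (hA : Module.finrank (ZMod 2) A = n) (u : Aˣ) :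
    ∃ g : Matrix.SpecialLinearGroup (Fin n) (ZMod 2), orderOf g = orderOf u := by
  let b := (Module.finBasisOfFinrankEq (ZMod 2) A hA)
  let M := Algebra.leftMulMatrix b
  have hdet : ∀ x : ZMod 2, IsUnit x → x = 1 := by decide
  have hu : IsUnit (M (u : A)).det := (Matrix.isUnit_iff_isUnit_det _).1 (u.isUnit.map M)
  let φ : Matrix.SpecialLinearGroup (Fin n) (ZMod 2) →* Matrix (Fin n) (Fin n) (ZMod 2) :=
    (Units.coeHom _).comp Matrix.SpecialLinearGroup.toGL
  have hφ : Function.Injective φ := fun x y h => Subtype.ext h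
  let g : Matrix.SpecialLinearGroup (Fin n) (ZMod 2) := ⟨M u, hdet _ hu⟩
  have h1 : orderOf (φ g) = orderOf g := orderOf_injective φ hφ g
  have h2 : orderOf (M (u : A)) = orderOf (u : A) :=
    orderOf_injective (M : A →* Matrix (Fin n) (Fin n) (ZMod 2))
      (Algebra.leftMulMatrix_injective b) (u : A)
  refine ⟨g, ?_⟩
  rw [← h1, ← orderOf_units (y := u), ← h2]
  rfl

theorem g_transfer' (n : ℕ) (A : Type) [Ring A] [Algebra (ZMod 2) A] [Module.Finite (ZMod 2) A]
    (hA : Module.finrank (ZMod 2) A ≤ n) (u : Aˣ) :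
    ∃ g : Matrix.SpecialLinearGroup (Fin n) (ZMod 2), orderOf u ∣ orderOf g := by
  obtain ⟨g, hg⟩ := g_transfer n (A × (Fin (n - Module.finrank (ZMod 2) A) → ZMod 2))
    (by rw [Module.finrank_prod]; simp; omega) (MulEquiv.prodUnits.symm (u, 1))
  refine ⟨g, ?_⟩
  rw [hg, MulEquiv.orderOf_eq, Prod.orderOf]
  exact Nat.dvd_lcm_left _ _

theorem e_pos (p : ℕ) (hp : p.Prime) (hp2 : p ≠ 2) : 0 < orderOf (2 : ZMod p) := by
  have := Fact.mk hp
  rw [orderOf_pos_iff]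
  apply isOfFinOrder_iff_pow_eq_one.2 ⟨p - 1, by have := hp.two_le; omega, ?_⟩
  apply ZMod.pow_card_sub_one_eq_one
  intro h0
  have : ((2:ℕ) : ZMod p) = 0 := by exact_mod_cast h0
  rw [ZMod.natCast_eq_zero_iff] at this
  exact hp2 ((Nat.prime_dvd_prime_iff_eq hp Nat.prime_two).1 this)

theorem e_dvd (p k : ℕ) : orderOf (2 : ZMod p) ∣ k ↔ p ∣ 2 ^ k - 1 := by
  rw [orderOf_dvd_iff_pow_eq_one, ← ZMod.natCast_eq_zero_iff, Nat.cast_sub Nat.one_le_two_pow]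
  push_cast
  rw [sub_eq_zero]

theorem gf_unit (k r : ℕ) (hk : k ≠ 0) (hr : r ∣ 2 ^ k - 1) :
    ∃ u : (GaloisField 2 k)ˣ, orderOf u = r := by
  obtain ⟨g, hg⟩ := IsCyclic.exists_generator (α := (GaloisField 2 k)ˣ)
  have hc : orderOf g = 2 ^ k - 1 := by
    rw [orderOf_eq_card_of_forall_mem_zpowers hg, Nat.card_units, GaloisField.card 2 k hk]
  have hpos : 2 ^ k - 1 ≠ 0 := by
    have := Nat.one_lt_two_pow hk
    omega
  obtain ⟨s, hs⟩ := hr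
  refine ⟨g ^ s, ?_⟩
  have hs0 : s ≠ 0 := by rintro rfl; simp at hs; omega
  rw [orderOf_pow_of_dvd hs0 (by rw [hc, hs]; exact Dvd.intro_left r rfl), hc, hs,
    Nat.mul_div_cancel _ (Nat.pos_of_ne_zero hs0)]

theorem c1 (n p q : ℕ) (hp : p.Prime) (hq : q.Prime) (hp2 : p ≠ 2) (hq2 : q ≠ 2) (hpq : p ≠ q)
    (h : orderOf (2 : ZMod p) + orderOf (2 : ZMod q) ≤ n) :
    ∃ g : Matrix.SpecialLinearGroup (Fin n) (ZMod 2), p * q ∣ orderOf g := by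
  have ha := (e_pos p hp hp2).ne'
  have hb := (e_pos q hq hq2).ne'
  obtain ⟨u, hu⟩ := gf_unit _ p ha ((e_dvd p _).1 dvd_rfl)
  obtain ⟨v, hv⟩ := gf_unit _ q hb ((e_dvd q _).1 dvd_rfl)
  obtain ⟨g, hg⟩ := g_transfer' n (GaloisField 2 (orderOf (2 : ZMod p)) × GaloisField 2 (orderOf (2 : ZMod q)))
    (by rw [Module.finrank_prod, GaloisField.finrank _ ha, GaloisField.finrank _ hb]; exact h)
    (MulEquiv.prodUnits.symm (u, v))
  refine ⟨g, ?_⟩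
  rw [MulEquiv.orderOf_eq, Prod.orderOf] at hg
  simp only [hu, hv] at hg
  rwa [Nat.Coprime.lcm_eq_mul ((Nat.coprime_primes hp hq).2 hpq)] at hg

theorem c2 (n p q : ℕ) (hp : p.Prime) (hq : q.Prime) (hq2 : q ≠ 2) (hpq : p ≠ q)
    (h : orderOf (2 : ZMod p) ∣ orderOf (2 : ZMod q)) (hn : orderOf (2 : ZMod q) ≤ n) :
    ∃ g : Matrix.SpecialLinearGroup (Fin n) (ZMod 2), p * q ∣ orderOf g := by
  have hb := (e_pos q hq hq2).ne'
  obtain ⟨v, hv⟩ := gf_unit _ (p * q) hb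
    (Nat.Coprime.mul_dvd_of_dvd_of_dvd ((Nat.coprime_primes hp hq).2 hpq) ((e_dvd p _).1 h) ((e_dvd q _).1 dvd_rfl))
  obtain ⟨g, hg⟩ := g_transfer' n (GaloisField 2 (orderOf (2 : ZMod q)))
    (by rw [GaloisField.finrank _ hb]; exact hn) v
  exact ⟨g, hv ▸ hg⟩

theorem c3 (n p : ℕ) (hp : p.Prime) (hp2 : p ≠ 2)
    (h : orderOf (2 : ZMod p) + 4 ≤ n) :
    ∃ g : Matrix.SpecialLinearGroup (Fin n) (ZMod 2), 2 * p ∣ orderOf g := by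
  have ha := (e_pos p hp hp2).ne'
  obtain ⟨u, hu⟩ := gf_unit _ p ha ((e_dvd p _).1 dvd_rfl)
  let w : (Matrix (Fin 2) (Fin 2) (ZMod 2))ˣ := ⟨!![0,1;1,0], !![0,1;1,0], by decide, by decide⟩
  have hw : orderOf w = 2 := by
    apply orderOf_eq_prime
    · apply Units.ext; decide
    · intro h
      have := congrArg Units.val h
      revert this; decide
  obtain ⟨g, hg⟩ := g_transfer' n (GaloisField 2 (orderOf (2 : ZMod p)) × Matrix (Fin 2) (Fin 2) (ZMod 2))
    (by rw [Module.finrank_prod, GaloisField.finrank _ ha, Module.finrank_matrix]; simpa using h)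
    (MulEquiv.prodUnits.symm (u, w))
  refine ⟨g, ?_⟩
  rw [MulEquiv.orderOf_eq, Prod.orderOf] at hg
  simp only [hu, hw] at hg
  rw [Nat.Coprime.lcm_eq_mul ((Nat.coprime_primes hp Nat.prime_two).2 hp2)] at hg
  rwa [mul_comm]

theorem sl_card (n : ℕ) : Nat.card (Matrix.SpecialLinearGroup (Fin n) (ZMod 2)) =
    ∏ i : Fin n, (2 ^ n - 2 ^ (i : ℕ)) := by
  have := Matrix.card_GL_field (𝔽 := ZMod 2) n
  rw [ZMod.card] at this
  rw [← this]
  have hdet : ∀ x : ZMod 2, IsUnit x → x = 1 := by decide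
  apply Nat.card_eq_of_bijective (Matrix.SpecialLinearGroup.toGL)
  constructor
  · intro x y h
    exact Subtype.ext (congrArg Units.val h)
  · intro g
    refine ⟨⟨g.val, hdet _ ((Matrix.isUnit_iff_isUnit_det _).1 g.isUnit)⟩, ?_⟩
    apply Units.ext
    rfl

theorem dvd_card (n p : ℕ) (hp : p.Prime) (hp2 : p ≠ 2) :
    p ∣ Nat.card (Matrix.SpecialLinearGroup (Fin n) (ZMod 2)) ↔ orderOf (2 : ZMod p) ≤ n := by
  have hfac : ∀ i : Fin n, 2 ^ n - 2 ^ (i:ℕ) = 2 ^ (i:ℕ) * (2 ^ (n - i) - 1) := by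
    intro i
    rw [Nat.mul_sub, ← pow_add, Nat.add_sub_of_le i.2.le, mul_one]
  rw [sl_card]
  constructor
  · intro h
    obtain ⟨i, _, hi⟩ := (Prime.dvd_finsetProd_iff hp.prime _).1 h
    rw [hfac, hp.dvd_mul] at hi
    rcases hi with hi | hi
    · exact absurd ((Nat.prime_dvd_prime_iff_eq hp Nat.prime_two).1 (hp.dvd_of_dvd_pow hi)) hp2
    · rw [← e_dvd] at hi
      have := Nat.le_of_dvd (by omega) hi
      omega
  · intro h
    have h0 := e_pos p hp hp2
    refine Dvd.dvd.trans ?_ (Finset.dvd_prod_of_mem _ (Finset.mem_univ (⟨n - orderOf (2 : ZMod p), by omega⟩ : Fin n)))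
    rw [hfac]
    apply Dvd.dvd.mul_left
    rw [← e_dvd]
    simp only
    rw [Nat.sub_sub_self h]

open Polynomial in
/-- An irreducible factor witnessing the `q`-part of the order. -/
theorem factor_exists (p q d : ℕ) (hq : q.Prime) (hq2 : q ≠ 2) (M : Matrix (Fin d) (Fin d) (ZMod 2))
    (h1 : M ^ (p * q) = 1) (h2 : M ^ p ≠ 1) :
    ∃ f : (ZMod 2)[X], Irreducible f ∧ f ∣ minpoly (ZMod 2) M ∧ orderOf (2 : ZMod q) ∣ f.natDegree := by
  set μ := minpoly (ZMod 2) M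
  set S : (ZMod 2)[X] := ∑ i ∈ Finset.range q, (X ^ p) ^ i with hS
  have hprod : S * (X ^ p - 1) = X ^ (p * q) - 1 := by
    rw [hS, geom_sum_mul, pow_mul]
  have hμ : μ ∣ S * (X ^ p - 1) := by
    rw [hprod]; apply minpoly.dvd; simp [h1]
  have hnot : ¬ IsCoprime μ S := by
    intro hc
    have := hc.dvd_of_dvd_mul_left hμ
    have h3 := (minpoly.dvd_iff).1 this
    simp at h3
    exact h2 (sub_eq_zero.1 h3)
  have hμ0 : μ ≠ 0 := minpoly.ne_zero (Matrix.isIntegral M)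
  have hgcd : ¬ IsUnit (EuclideanDomain.gcd μ S) := by
    rwa [EuclideanDomain.gcd_isUnit_iff]
  have hg0 : EuclideanDomain.gcd μ S ≠ 0 := by
    intro h
    exact hμ0 (EuclideanDomain.gcd_eq_zero_iff.1 h).1
  obtain ⟨f, hf, hfd⟩ := WfDvdMonoid.exists_irreducible_factor hgcd hg0
  have hfμ := hfd.trans (EuclideanDomain.gcd_dvd_left _ _)
  have hfS := hfd.trans (EuclideanDomain.gcd_dvd_right _ _)
  refine ⟨f, hf, hfμ, ?_⟩
  have := Fact.mk hf
  let K := AdjoinRoot f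
  let a : K := AdjoinRoot.root f
  have hSa : ∑ i ∈ Finset.range q, (a ^ p) ^ i = 0 := by
    have : AdjoinRoot.mk f S = 0 := AdjoinRoot.mk_eq_zero.2 hfS
    simpa [hS, map_sum] using this
  have : CharP K 2 := charP_of_injective_algebraMap (algebraMap (ZMod 2) K).injective 2
  have hap : a ^ p ≠ 1 := by
    intro h
    rw [h] at hSa
    simp at hSa
    rw [CharP.cast_eq_zero_iff K 2] at hSa
    exact hq2 ((Nat.prime_dvd_prime_iff_eq Nat.prime_two hq).1 hSa).symm
  have hapq : (a ^ p) ^ q = 1 := by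
    have := geom_sum_mul (a ^ p) q
    rw [hSa, zero_mul] at this
    exact (sub_eq_zero.1 this.symm)
  have := Fact.mk hq
  have hord : orderOf (a ^ p) = q := orderOf_eq_prime hapq hap
  let pb := AdjoinRoot.powerBasis hf.ne_zero
  have hfr : Module.finrank (ZMod 2) K = f.natDegree := pb.finrank
  have : Module.Finite (ZMod 2) K := pb.finite
  have : Finite K := Module.finite_of_finite (ZMod 2)
  have : Fintype K := Fintype.ofFinite K
  have hcard : Fintype.card K = 2 ^ f.natDegree := by
    rw [Module.card_eq_pow_finrank (K := ZMod 2), hfr, ZMod.card]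
  rw [e_dvd, ← hord, ← hcard]
  apply orderOf_dvd_of_pow_eq_one
  apply FiniteField.pow_card_sub_one_eq_one
  intro h
  rw [h, zero_pow hq.ne_zero] at hapq
  exact zero_ne_one hapq

theorem indep (n p q : ℕ) (hp : p.Prime) (hq : q.Prime) (hp2 : p ≠ 2) (hq2 : q ≠ 2)
    (ha : n < 2 * orderOf (2 : ZMod p)) (hb : n < 2 * orderOf (2 : ZMod q))
    (hne : orderOf (2 : ZMod p) ≠ orderOf (2 : ZMod q))
    (g : Matrix.SpecialLinearGroup (Fin n) (ZMod 2)) : ¬ (p * q ∣ orderOf g) := by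
  intro h
  have hg0 : orderOf g ≠ 0 := (orderOf_pos g).ne'
  obtain ⟨s, hs⟩ := h
  have hs0 : s ≠ 0 := by rintro rfl; exact hg0 (by rw [hs, mul_zero])
  have hord : orderOf (g ^ s) = p * q := by
    rw [orderOf_pow_of_dvd hs0 (by rw [hs]; exact Dvd.intro_left _ rfl), hs,
      Nat.mul_div_cancel _ (Nat.pos_of_ne_zero hs0)]
  set x := g ^ s
  have hpow : ∀ k, (x : Matrix (Fin n) (Fin n) (ZMod 2)) ^ k = 1 ↔ p * q ∣ k := by
    intro k
    rw [← hord, orderOf_dvd_iff_pow_eq_one, ← Matrix.SpecialLinearGroup.coe_pow]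
    constructor
    · intro h; exact Subtype.ext h
    · intro h; rw [h]; rfl
  have hp3 := hp.two_le
  have hq3 := hq.two_le
  obtain ⟨f, hf, hfμ, hfd⟩ := factor_exists p q n hq hq2 x ((hpow _).2 dvd_rfl)
    (by rw [Ne, hpow]; intro h; have := Nat.le_of_dvd hp.pos h; nlinarith)
  obtain ⟨f', hf', hfμ', hfd'⟩ := factor_exists q p n hp hp2 x ((hpow _).2 (by rw [mul_comm]))
    (by rw [Ne, hpow]; intro h; have := Nat.le_of_dvd hq.pos h; nlinarith)
  set μ := minpoly (ZMod 2) (x : Matrix (Fin n) (Fin n) (ZMod 2))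
  have hμ0 : μ ≠ 0 := minpoly.ne_zero (Matrix.isIntegral _)
  have hμn : μ.natDegree ≤ n := by
    have := Polynomial.natDegree_le_of_dvd (Matrix.minpoly_dvd_charpoly (x : Matrix (Fin n) (Fin n) (ZMod 2)))
      (Matrix.charpoly_monic _).ne_zero
    rwa [Matrix.charpoly_natDegree_eq_dim, Fintype.card_fin] at this
  have hfpos := hf.natDegree_pos
  have hfpos' := hf'.natDegree_pos
  have hle := Nat.le_of_dvd hfpos hfd
  have hle' := Nat.le_of_dvd hfpos' hfd'
  by_cases hass : f ∣ f'
  · have hdeg : f.natDegree = f'.natDegree :=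
      Polynomial.natDegree_eq_of_degree_eq (Polynomial.degree_eq_degree_of_associated (hf.associated_of_dvd hf' hass))
    have hfn := (Polynomial.natDegree_le_of_dvd hfμ hμ0).trans hμn
    obtain ⟨r, hr⟩ := hfd
    obtain ⟨t, ht⟩ := hfd'
    have hr2 : r < 2 := by
      by_contra! h2
      nlinarith [Nat.mul_le_mul_left (orderOf (2 : ZMod q)) h2]
    have ht2 : t < 2 := by
      by_contra! h2
      nlinarith [Nat.mul_le_mul_left (orderOf (2 : ZMod p)) h2]
    interval_cases r <;> interval_cases t <;> omega
  · have hc : IsCoprime f f' := (hf.coprime_iff_not_dvd).2 hass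
    have := Polynomial.natDegree_le_of_dvd (hc.mul_dvd hfμ hfμ') hμ0
    rw [Polynomial.natDegree_mul hf.ne_zero hf'.ne_zero] at this
    omega

theorem comb (n h : ℕ) (hn : n = 2 * h) (P : Finset ℕ) (e : ℕ → ℕ) (hpos : ∀ p ∈ P, 0 < e p)
    (hle : ∀ p ∈ P, e p ≤ n) (hsum : ∀ p ∈ P, ∀ q ∈ P, p ≠ q → n < e p + e q)
    (hdvd : ∀ p ∈ P, ∀ q ∈ P, p ≠ q → ¬ e p ∣ e q) : P.card ≤ h := by
  have hinj : Set.InjOn e P := by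
    intro p hp q hq hpq
    by_contra hne
    exact hdvd p hp q hq hne (by rw [hpq])
  by_cases hex : ∃ p0 ∈ P, e p0 ≤ h
  · obtain ⟨p0, hp0, he0⟩ := hex
    have h0 := hpos p0 hp0
    have hmul : (n / e p0) * e p0 ∈ Finset.Ioc (n - e p0) n := by
      rw [Finset.mem_Ioc]
      have h1 := Nat.div_add_mod n (e p0)
      have h2 := Nat.mod_lt n h0
      rw [mul_comm] at h1
      omega
    have hcard : (P.erase p0).card ≤ ((Finset.Ioc (n - e p0) n).erase ((n / e p0) * e p0)).card := by
      apply Finset.card_le_card_of_injOn e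
      · intro q hq
        have hq' := Finset.mem_erase.1 hq
        have h1 := hsum p0 hp0 q hq'.2 hq'.1.symm
        have h2 := hle q hq'.2
        rw [Finset.mem_coe, Finset.mem_erase, Finset.mem_Ioc]
        refine ⟨?_, by omega, h2⟩
        intro h3
        exact hdvd p0 hp0 q hq'.2 hq'.1.symm (h3 ▸ Dvd.intro_left _ rfl)
      · exact hinj.mono (by intro x hx; exact Finset.mem_of_mem_erase hx)
    rw [Finset.card_erase_of_mem hp0, Finset.card_erase_of_mem hmul, Nat.card_Ioc] at hcard
    omega
  · push Not at hex
    have : P.card ≤ (Finset.Ioc h n).card := by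
      apply Finset.card_le_card_of_injOn e
      · intro q hq
        rw [Finset.mem_coe, Finset.mem_Ioc]
        exact ⟨hex q hq, hle q hq⟩
      · exact hinj
    rw [Nat.card_Ioc] at this
    omega

/-- Let `m > 5` and `L = SL_{2^m}(F₂)`.  The independence number of `L` is
`2^(m-1)`: the maximum cardinality of a set `P` of primes dividing `|L|` such that for all
distinct `p, q ∈ P` no element of `L` has order divisible by `p * q` equals `2^(m-1)`. -/
theorem independence_number_of_L (m : ℕ) (hm : 5 < m) :
    IsGreatest
      {k : ℕ | ∃ P : Finset ℕ,
        (∀ p ∈ P, p.Prime ∧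
          p ∣ Nat.card (Matrix.SpecialLinearGroup (Fin (2 ^ m)) (ZMod 2))) ∧
        (∀ p ∈ P, ∀ q ∈ P, p ≠ q →
          ∀ g : Matrix.SpecialLinearGroup (Fin (2 ^ m)) (ZMod 2), ¬ (p * q ∣ orderOf g)) ∧
        P.card = k}
      (2 ^ (m - 1)) := by
  have hnh : 2 ^ m = 2 * 2 ^ (m - 1) := by
    rw [← pow_succ']; congr 1; omega
  have h32 : 32 ≤ 2 ^ (m - 1) := by
    calc 32 = 2 ^ 5 := by norm_num
      _ ≤ _ := Nat.pow_le_pow_right (by norm_num) (by omega)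
  generalize 2 ^ (m - 1) = h at *
  generalize 2 ^ m = n at *
  constructor
  · have hz : ∀ k : ℕ, ∃ p : ℕ, 7 ≤ k → (p.Prime ∧ orderOf (2 : ZMod p) = k) := by
      intro k
      by_cases hk : 7 ≤ k
      · obtain ⟨p, hp⟩ := zs k hk
        exact ⟨p, fun _ => hp⟩
      · exact ⟨0, fun h => absurd h hk⟩
    choose f hf using hz
    have hf2 : ∀ k, 7 ≤ k → f k ≠ 2 := by
      intro k hk h2
      have := (hf k hk).2
      rw [h2, show (2 : ZMod 2) = 0 from rfl, orderOf_zero] at this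
      omega
    refine ⟨(Finset.Ioc h n).image f, ?_, ?_, ?_⟩
    · intro p hp
      obtain ⟨k, hk, rfl⟩ := Finset.mem_image.1 hp
      rw [Finset.mem_Ioc] at hk
      have h1 := hf k (by omega)
      refine ⟨h1.1, ?_⟩
      rw [dvd_card n _ h1.1 (hf2 k (by omega)), h1.2]
      exact hk.2
    · intro p hp q hq hpq
      obtain ⟨k, hk, rfl⟩ := Finset.mem_image.1 hp
      obtain ⟨l, hl, rfl⟩ := Finset.mem_image.1 hq
      rw [Finset.mem_Ioc] at hk hl
      have h1 := hf k (by omega)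
      have h2 := hf l (by omega)
      refine indep n _ _ h1.1 h2.1 (hf2 k (by omega)) (hf2 l (by omega)) (by rw [h1.2]; omega)
        (by rw [h2.2]; omega) ?_
      rw [h1.2, h2.2]
      rintro rfl
      exact hpq rfl
    · rw [Finset.card_image_of_injOn, Nat.card_Ioc]
      · omega
      · intro k hk l hl hkl
        rw [Finset.mem_coe, Finset.mem_Ioc] at hk hl
        rw [← (hf k (by omega)).2, ← (hf l (by omega)).2, hkl]
  · rintro _ ⟨P, hP, hind, rfl⟩
    by_cases h2 : 2 ∈ P
    · have hcard : (P.erase 2).card ≤ (Finset.Ioc (n - 4) n).card := by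
        apply Finset.card_le_card_of_injOn (fun p => orderOf (2 : ZMod p))
        · intro p hp
          have hp' := Finset.mem_erase.1 hp
          have hpp := hP p hp'.2
          rw [Finset.mem_coe, Finset.mem_Ioc]
          refine ⟨?_, (dvd_card n p hpp.1 hp'.1).1 hpp.2⟩
          by_contra hlt
          simp only at hlt
          obtain ⟨g, hg⟩ := c3 n p hpp.1 hp'.1 (by omega)
          exact hind 2 h2 p hp'.2 hp'.1.symm g hg
        · intro p hp q hq hpq
          have hp' := Finset.mem_erase.1 hp
          have hq' := Finset.mem_erase.1 hq
          by_contra hne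
          obtain ⟨g, hg⟩ := c2 n p q (hP p hp'.2).1 (hP q hq'.2).1 hq'.1 hne (dvd_of_eq hpq)
            ((dvd_card n q (hP q hq'.2).1 hq'.1).1 (hP q hq'.2).2)
          exact hind p hp'.2 q hq'.2 hne g hg
      rw [Finset.card_erase_of_mem h2, Nat.card_Ioc] at hcard
      omega
    · have hn2 : ∀ p ∈ P, p ≠ 2 := fun p hp h => h2 (h ▸ hp)
      have hle : ∀ p ∈ P, orderOf (2 : ZMod p) ≤ n := fun p hp =>
        (dvd_card n p (hP p hp).1 (hn2 p hp)).1 (hP p hp).2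
      refine comb n h hnh P (fun p => orderOf (2 : ZMod p))
        (fun p hp => e_pos p (hP p hp).1 (hn2 p hp)) hle ?_ ?_
      · intro p hp q hq hne
        by_contra hlt
        obtain ⟨g, hg⟩ := c1 n p q (hP p hp).1 (hP q hq).1 (hn2 p hp) (hn2 q hq) hne (not_lt.1 hlt)
        exact hind p hp q hq hne g hg
      · intro p hp q hq hne hd
        obtain ⟨g, hg⟩ := c2 n p q (hP p hp).1 (hP q hq).1 (hn2 q hq) hne hd (hle q hq)
        exact hind p hp q hq hne g hg
end

section
/- Let s and p be distinct primes, and let H be a finite group which is a semidirect product of a normal p-subgroup T and a cyclic subgroup C = ⟨g⟩ of order s, with [T, g] ≠ 1. Suppose H acts faithfully and linearly on a finite-dimensional vector space V over a field of positive characteristic t with t ≠ p. If the minimal polynomial of the linear transformation by which g acts on V is not equal to X^s − 1, then: (i) there exists a nontrivial x ∈ T with gxg^{-1} = x (i.e., C_T(g) ≠ 1); (ii) T is nonabelian; and (iii) p = 2 and s = 2^{2^δ} + 1 is a Fermat prime for some δ ≥ 0. -/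
open Polynomial

theorem hh_cent_step {K V : Type*} [Field K] [AddCommGroup V] [Module K V]
    [FiniteDimensional K V] (g P : Module.End K V) (a : K) (hP : P = g - algebraMap K _ a)
    (g' : Module.End K (LinearMap.range P)) (hg' : ∀ x, (g' x : V) = g x) :
    (Module.finrank K (LinearMap.ker P)) ^ 2 +
      Module.finrank K (Subalgebra.centralizer K {g'}) ≤
      Module.finrank K (Subalgebra.centralizer K {g}) := by
  classical
  obtain ⟨π, hπ⟩ := (LinearMap.range P).subtype.exists_leftInverse_of_injective (by simp)
  obtain ⟨σ, hσ⟩ := P.rangeRestrict.exists_rightInverse_of_surjective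
    (LinearMap.range_rangeRestrict P)
  have hπ' : ∀ x : (LinearMap.range P), π x = x := fun x => LinearMap.congr_fun hπ x
  have hσ' : ∀ x : (LinearMap.range P), P (σ x) = x := fun x => congrArg Subtype.val (LinearMap.congr_fun hσ x)
  have hPv : ∀ v, P v = g v - a • v := by intro v; rw [hP]; simp [Module.algebraMap_end_apply]
  let C' := Subalgebra.toSubmodule (Subalgebra.centralizer K {g'})
  let C := Subalgebra.toSubmodule (Subalgebra.centralizer K {g})
  have memC : ∀ B : Module.End K V, B ∈ C ↔ ∀ v, P (B v) = B (P v) := by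
    intro B
    simp only [C, Subalgebra.mem_toSubmodule, Subalgebra.mem_centralizer_iff,
      Set.mem_singleton_iff, forall_eq, hPv, map_sub, map_smul, sub_left_inj]
    exact LinearMap.ext_iff
  have memC' : ∀ B : Module.End K (LinearMap.range P), B ∈ C' → ∀ v : (LinearMap.range P), P (B v) = B ⟨P v, LinearMap.mem_range_self P v⟩ := by
    intro B hB v
    simp only [C', Subalgebra.mem_toSubmodule, Subalgebra.mem_centralizer_iff,
      Set.mem_singleton_iff, forall_eq] at hB
    have h1 : (⟨P v, LinearMap.mem_range_self P v⟩ : (LinearMap.range P)) = g' v - a • v := by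
      apply Subtype.ext; simp [hPv, hg']
    rw [h1, map_sub, map_smul]
    have := LinearMap.congr_fun hB v
    simp only [Module.End.mul_apply] at this
    rw [← this, hPv]; simp [hg']
  let F : ((V ⧸ (LinearMap.range P)) →ₗ[K] LinearMap.ker P) × C' →ₗ[K] Module.End K V :=
    { toFun := fun q => (LinearMap.ker P).subtype ∘ₗ q.1 ∘ₗ (LinearMap.range P).mkQ +
        (LinearMap.range P).subtype ∘ₗ (q.2 : Module.End K (LinearMap.range P)) ∘ₗ π +
        σ ∘ₗ (q.2 : Module.End K (LinearMap.range P)) ∘ₗ P.rangeRestrict ∘ₗ (LinearMap.id - (LinearMap.range P).subtype ∘ₗ π)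
      map_add' := by
        intro x y; ext v; simp; abel
      map_smul' := by
        intro c x; ext v; simp }
  have hF : ∀ q v, F q v = (q.1 ((LinearMap.range P).mkQ v) : V) + ((q.2 : Module.End K (LinearMap.range P)) (π v) : V) +
      σ ((q.2 : Module.End K (LinearMap.range P)) (P.rangeRestrict (v - π v))) := fun q v => rfl
  have hFC : ∀ q, F q ∈ C := by
    intro q
    rw [memC]
    intro v
    have hq := memC' q.2 q.2.2
    rw [hF, hF]
    simp only [map_add, hσ', hq]
    have h0 : P (q.1 ((LinearMap.range P).mkQ v) : V) = 0 := (q.1 ((LinearMap.range P).mkQ v)).2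
    have h1 : (LinearMap.range P).mkQ (P v) = 0 := by simp
    have h2 : π (P v) = P.rangeRestrict v := hπ' (P.rangeRestrict v)
    rw [h0, h1, h2]
    simp only [map_sub]
    have h3 : (⟨P (π v : V), LinearMap.mem_range_self P _⟩ : (LinearMap.range P)) = P.rangeRestrict (π v : V) := rfl
    have h4 : P.rangeRestrict (P v) = P.rangeRestrict (P.rangeRestrict v : V) := rfl
    rw [h3, h4]; simp
  have hinj : Function.Injective F := by
    rw [injective_iff_map_eq_zero]
    intro q hq
    have hq2 : q.2 = 0 := by
      apply Subtype.ext; apply LinearMap.ext; intro x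
      have := LinearMap.congr_fun hq x
      rw [hF, hπ'] at this
      have h1 : (LinearMap.range P).mkQ (x : V) = 0 := by simp
      rw [h1] at this
      simpa using this
    have hq1 : q.1 = 0 := by
      apply LinearMap.ext; intro x
      obtain ⟨v, rfl⟩ := (LinearMap.range P).mkQ_surjective x
      have := LinearMap.congr_fun hq v
      rw [hF, hq2] at this
      simpa using this
    exact Prod.ext hq1 hq2
  have key := LinearMap.finrank_le_finrank_of_injective (f := F.codRestrict C hFC)
    (by intro x y h; exact hinj (congrArg Subtype.val h))
  have : Module.Free K C' := Module.Free.of_divisionRing K C'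
  have : Module.Finite K C' := FiniteDimensional.finiteDimensional_submodule C'
  rw [Module.finrank_prod, Module.finrank_linearMap] at key
  have e1 : Module.finrank K (V ⧸ (LinearMap.range P)) = Module.finrank K (LinearMap.ker P) := by
    have h1 := Submodule.finrank_quotient_add_finrank (LinearMap.range P)
    have h2 := LinearMap.finrank_range_add_finrank_ker P
    omega
  rw [e1] at key
  rw [pow_two]; exact key

theorem hh_cent {K : Type*} [Field K] [IsAlgClosed K] (n : ℕ) :
    ∀ (V : Type*) [AddCommGroup V] [Module K V] [FiniteDimensional K V] (g : Module.End K V)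
    (f : K[X]), f ≠ 0 → f.natDegree = n → aeval g f = 0 →
    (Module.finrank K V) ^ 2 ≤ n * Module.finrank K (Subalgebra.centralizer K {g}) := by
  induction n with
  | zero =>
    intro V _ _ _ g f hf0 hfn hf
    obtain ⟨c, rfl⟩ := natDegree_eq_zero.1 hfn
    have hc : c ≠ 0 := by rintro rfl; simp at hf0
    have : Subsingleton V := by
      refine ⟨fun x y => ?_⟩
      have h : ∀ v : V, v = 0 := fun v => by
        have := LinearMap.congr_fun hf v
        simpa [Module.algebraMap_end_apply, hc] using this
      rw [h x, h y]
    simp [Module.finrank_zero_of_subsingleton]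
  | succ n ih =>
    intro V _ _ _ g f hf0 hfn hf
    obtain ⟨a, ha⟩ := IsAlgClosed.exists_root f (by
      intro h; rw [natDegree_eq_of_degree_eq_some h] at hfn; exact absurd hfn (Nat.succ_ne_zero n).symm)
    obtain ⟨f', rfl⟩ := dvd_iff_isRoot.2 ha
    have hf'0 : f' ≠ 0 := right_ne_zero_of_mul hf0
    have hdeg : f'.natDegree = n := by
      rw [natDegree_mul (X_sub_C_ne_zero a) hf'0, natDegree_X_sub_C] at hfn; omega
    set P : Module.End K V := g - algebraMap K _ a with hP
    have hPg : Commute P g := (Commute.refl g).sub_left (Algebra.commutes a g)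
    have hmaps : ∀ x ∈ LinearMap.range P, g x ∈ LinearMap.range P := by
      rintro _ ⟨v, rfl⟩
      exact ⟨g v, LinearMap.congr_fun hPg.eq v⟩
    set g' : Module.End K (LinearMap.range P) := g.restrict hmaps with hg'
    have hgx : ∀ x, (g' x : V) = g x := fun x => rfl
    have hae : ∀ (q : K[X]) (x : LinearMap.range P), ((aeval g' q) x : V) = aeval g q x := by
      intro q x
      induction q using Polynomial.induction_on' with
      | add p q hp hq => simp [hp, hq]
      | monomial m c =>
        simp only [aeval_monomial, Module.End.mul_apply, Module.algebraMap_end_apply,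
          Submodule.coe_smul]
        congr 1
        induction m generalizing x with
        | zero => simp
        | succ m ihm => rw [pow_succ, pow_succ, Module.End.mul_apply, Module.End.mul_apply, ihm, hgx]
    have h1 := hh_cent_step g P a hP g' hgx
    have h2 := ih (LinearMap.range P) g' f' hf'0 hdeg (by
      apply LinearMap.ext
      rintro ⟨_, v, rfl⟩
      apply Subtype.ext
      rw [hae]
      have := LinearMap.congr_fun hf v
      rw [mul_comm, map_mul] at this
      simpa [hP] using this)
    have h3 := LinearMap.finrank_range_add_finrank_ker P
    set c := Module.finrank K (Subalgebra.centralizer K {g})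
    set c' := Module.finrank K (Subalgebra.centralizer K {g'})
    set x := Module.finrank K (LinearMap.range P)
    set y := Module.finrank K (LinearMap.ker P)
    rw [← h3]
    rcases Nat.eq_zero_or_pos n with hn | hn
    · subst hn
      have : x = 0 := by simpa using h2
      rw [this]; simp; omega
    · have h4 : (n + 1) * (y ^ 2 + c') ≤ (n + 1) * c := Nat.mul_le_mul_left _ h1
      refine le_trans ?_ h4
      zify at *
      have hn' : (0 : ℤ) < n := by exact_mod_cast hn
      have : (n : ℤ) * (x + y) ^ 2 ≤ n * ((n + 1) * (y ^ 2 + c')) := by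
        nlinarith [sq_nonneg ((x : ℤ) - n * y)]
      exact le_of_mul_le_mul_left this hn'

theorem hh_charIndep {K M A ι : Type*} [Field K] [AddCommGroup M] [Module K M] [Monoid A]
    (χ : ι → (A →* K)) (hχ : Function.Injective χ) (σ : A → Module.End K M) (v : ι → M)
    (hv : ∀ i, v i ≠ 0) (h : ∀ y i, σ y (v i) = χ i y • v i) : LinearIndependent K v := by
  classical
  rw [linearIndependent_iff']
  intro S a ha i hi
  have hL : LinearIndependent K (fun i => (χ i : A → K)) :=
    (linearIndependent_monoidHom A K).comp χ hχ
  by_contra hai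
  have h0 : a i • v i ≠ 0 := smul_ne_zero hai (hv i)
  apply h0
  rw [← Module.forall_dual_apply_eq_zero_iff K]
  intro ℓ
  have := (linearIndependent_iff'.1 hL) S (fun j => ℓ (a j • v j)) (by
    ext y
    have h1 := congrArg (fun m => ℓ (σ y m)) ha
    simp only [map_sum, map_smul, h, map_zero] at h1
    simp only [Finset.sum_apply, Pi.smul_apply, Pi.zero_apply]
    rw [← h1]
    apply Finset.sum_congr rfl
    intro j _
    simp only [map_smul, smul_eq_mul]; ring) i hi
  exact this

theorem hh_joint {K V A : Type*} [Field K] [IsAlgClosed K] [AddCommGroup V] [Module K V]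
    [FiniteDimensional K V] [Group A] [Finite A] (hcomm : ∀ x y : A, x * y = y * x)
    (hcard : (Nat.card A : K) ≠ 0) (ρ : A →* Module.End K V) :
    ⨆ χ : A → K, ⨅ i, (ρ i).eigenspace (χ i) = ⊤ := by
  have hss : ∀ a, (ρ a).IsSemisimple := by
    intro a
    apply Module.End.isSemisimple_of_squarefree_aeval_eq_zero
      (p := (X ^ Nat.card A - 1 : K[X]))
    · exact (X_pow_sub_one_separable_iff.2 hcard).squarefree
    · rw [map_sub, map_pow, aeval_X, map_one, ← map_pow, pow_card_eq_one', map_one, sub_self]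
  have h := Module.End.iSup_iInf_maxGenEigenspace_eq_top_of_iSup_maxGenEigenspace_eq_top_of_commute
    (fun a => ρ a) (fun i j _ => by
      show ρ i * ρ j = ρ j * ρ i
      rw [← map_mul, ← map_mul, hcomm]) (fun i => by
      simp_rw [(hss i).isFinitelySemisimple.maxGenEigenspace_eq_eigenspace]
      exact (hss i).iSup_eigenspace_eq_top)
  simpa only [(hss _).isFinitelySemisimple.maxGenEigenspace_eq_eigenspace] using h

theorem hh_abelian {K V A : Type*} [Field K] [IsAlgClosed K] [AddCommGroup V] [Module K V]
    [FiniteDimensional K V] [Group A] [Finite A] (hcomm : ∀ x y : A, x * y = y * x)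
    (hcard : (Nat.card A : K) ≠ 0) (ρ : A →* Module.End K V) (s : ℕ) (hs : s.Prime)
    (φ : Monoid.End A) (hφ : φ ^ s = 1) (G : Module.End K V) (hG : G ^ s = 1)
    (hGρ : ∀ x, G * ρ x = ρ (φ x) * G)
    (f : K[X]) (hf0 : f ≠ 0) (hfn : f.natDegree < s) (hf : aeval G f = 0) :
    ∀ x, ρ (φ x) = ρ x := by
  intro x
  have hpow : ∀ (i : ℕ) y, G ^ i * ρ y = ρ ((φ ^ i) y) * G ^ i := by
    intro i
    induction i with
    | zero => intro y; simp
    | succ i ih =>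
      intro y
      rw [pow_succ, mul_assoc, hGρ, ← mul_assoc, ih, mul_assoc, pow_succ φ]; rfl
  have key : (⊤ : Submodule K V) ≤ LinearMap.eqLocus (ρ (φ x)) (ρ x) := by
    rw [← hh_joint hcomm hcard ρ]
    refine iSup_le fun χ => ?_
    intro v hv
    rw [Submodule.mem_iInf] at hv
    have hv' : ∀ y, ρ y v = χ y • v := fun y => Module.End.mem_eigenspace_iff.1 (hv y)
    rw [LinearMap.mem_eqLocus]
    by_cases hv0 : v = 0
    · simp [hv0]
    let χ' : A →* K :=
      { toFun := χ
        map_one' := by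
          have := hv' 1
          rw [map_one, Module.End.one_apply] at this
          have h2 : (χ 1 - 1) • v = 0 := by rw [sub_smul, one_smul, ← this, sub_self]
          exact sub_eq_zero.1 ((smul_eq_zero.1 h2).resolve_right hv0)
        map_mul' := by
          intro y z
          have := hv' (y * z)
          rw [map_mul, Module.End.mul_apply, hv', map_smul, hv'] at this
          have h2 : (χ (y * z) - χ y * χ z) • v = 0 := by
            rw [sub_smul, ← this, mul_comm, mul_smul, sub_self]
          exact sub_eq_zero.1 ((smul_eq_zero.1 h2).resolve_right hv0) }
    let F : (A →* K) → (A →* K) := fun ψ => ψ.comp φ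
    have hF : ∀ i ψ, F^[i] ψ = ψ.comp (φ ^ i : Monoid.End A) := by
      intro i
      induction i with
      | zero => intro ψ; rfl
      | succ i ih =>
        intro ψ
        rw [Function.iterate_succ_apply, ih, pow_succ']; rfl
    have hFs : Function.IsPeriodicPt F s χ' := by
      rw [Function.IsPeriodicPt, Function.IsFixedPt, hF, hφ]; ext y; rfl
    by_cases hfix : F χ' = χ'
    · rw [hv', hv']
      congr 1
      exact DFunLike.congr_fun hfix x
    exfalso
    have hnp : ∀ d, 0 < d → d < s → F^[d] χ' ≠ χ' := by
      intro d hd hds hdd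
      have h1 := Function.IsPeriodicPt.gcd (show Function.IsPeriodicPt F d χ' from hdd) hFs
      rw [Nat.Coprime.gcd_eq_one ((Nat.coprime_of_lt_prime hd.ne' hds hs).symm)] at h1
      exact hfix h1
    have hlt : ∀ i j : Fin s, i < j → F^[s - i] χ' ≠ F^[s - j] χ' := by
      intro i j hij he
      have h1 : F^[j] (F^[s - i] χ') = F^[j] (F^[s - j] χ') := by rw [he]
      rw [← Function.iterate_add_apply, ← Function.iterate_add_apply] at h1
      have e1 : (j : ℕ) + (s - j) = s := by omega
      have e2 : (j : ℕ) + (s - i) = (j - i) + s := by omega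
      rw [e1, e2, Function.iterate_add_apply, hFs] at h1
      exact hnp (j - i) (by omega) (by omega) h1
    have hinj : Function.Injective (fun i : Fin s => F^[s - i] χ') := by
      intro i j he
      rcases lt_trichotomy i j with h | h | h
      · exact absurd he (hlt i j h)
      · exact h
      · exact absurd he.symm (hlt j i h)
    have hGinj : ∀ i w, (G ^ i) w = 0 → i ≤ s → w = 0 := by
      intro i w hw hi
      have : (G ^ (s - i) * G ^ i) w = 0 := by rw [Module.End.mul_apply, hw, map_zero]
      rwa [← pow_add, Nat.sub_add_cancel hi, hG, Module.End.one_apply] at this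
    have hLI := hh_charIndep (K := K) (fun i : Fin s => F^[s - i] χ') hinj (fun y => ρ y)
      (fun i : Fin s => (G ^ (i : ℕ)) v) (fun i h => hv0 (hGinj _ _ h i.2.le)) (by
        intro y i
        have h1 := hpow i ((φ ^ (s - i : ℕ)) y)
        have h2 : (φ ^ (i : ℕ)) ((φ ^ (s - i : ℕ)) y) = y := by
          have : (φ ^ (i : ℕ) * φ ^ (s - i : ℕ)) y = y := by
            rw [← pow_add, Nat.add_sub_cancel' i.2.le, hφ]; rfl
          exact this
        rw [h2] at h1
        have h3 := LinearMap.congr_fun h1 v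
        simp only [Module.End.mul_apply] at h3
        show ρ y ((G ^ (i : ℕ)) v) = _
        rw [← h3, hv', map_smul, hF]
        rfl)
    have hsum := LinearMap.congr_fun hf v
    rw [aeval_eq_sum_range' hfn, ← Fin.sum_univ_eq_sum_range (fun i => f.coeff i • G ^ i)] at hsum
    simp only [LinearMap.sum_apply, LinearMap.smul_apply, LinearMap.zero_apply] at hsum
    have hz := Fintype.linearIndependent_iff.1 hLI (fun i => f.coeff i) hsum
    apply hf0
    ext i
    by_cases hi : i < s
    · simpa using hz ⟨i, hi⟩
    · rw [coeff_eq_zero_of_natDegree_lt (by omega)]; simp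
  ext v
  exact key (Submodule.mem_top (x := v))

theorem hh_fixed {Q : Type*} [Group Q] {s p : ℕ} (hs : s.Prime) (hp : p.Prime) (hsp : s ≠ p)
    (hQ : IsPGroup p Q) (φ : Monoid.End Q) (hφ : φ ^ s = 1) (x : Q)
    (h : φ (x⁻¹ * φ x) = x⁻¹ * φ x) : φ x = x := by
  set d := x⁻¹ * φ x with hd
  have hx : φ x = x * d := by simp [hd]
  have hi : ∀ i : ℕ, (φ ^ i) x = x * d ^ i := by
    intro i
    induction i with
    | zero => simp
    | succ i ih =>
      rw [pow_succ']
      show φ ((φ ^ i) x) = _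
      rw [ih, map_mul, map_pow, h, hx, mul_assoc, ← pow_succ']
  have h1 : d ^ s = 1 := by
    have := hi s
    rw [hφ] at this
    have h2 : x = x * d ^ s := this
    exact (mul_eq_left.1 h2.symm)
  obtain ⟨k, hk⟩ := hQ d
  have h3 : orderOf d ∣ 1 := by
    have := Nat.dvd_gcd (orderOf_dvd_of_pow_eq_one h1) (orderOf_dvd_of_pow_eq_one hk)
    rwa [Nat.Coprime.gcd_eq_one (Nat.Coprime.pow_right k ((Nat.coprime_primes hs hp).2 hsp))] at this
  have h4 : d = 1 := orderOf_eq_one_iff.1 (Nat.dvd_one.1 h3)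
  rw [hx, h4, mul_one]

theorem hh_bij {Q : Type*} [Group Q] {s : ℕ} (hs : s.Prime) (φ : Monoid.End Q)
    (hφ : φ ^ s = 1) : Function.Bijective φ := by
  have h1 : ∀ x, φ ((φ ^ (s - 1)) x) = x := by
    intro x
    have : (φ * φ ^ (s - 1)) x = x := by
      rw [← pow_succ', Nat.sub_add_cancel hs.one_le, hφ]; rfl
    exact this
  have h2 : ∀ x, (φ ^ (s - 1)) (φ x) = x := by
    intro x
    have : (φ ^ (s - 1) * φ) x = x := by
      rw [← pow_succ, Nat.sub_add_cancel hs.one_le, hφ]; rfl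
    exact this
  exact ⟨Function.LeftInverse.injective h2, Function.RightInverse.surjective h1⟩

theorem hh_normal_central {Q : Type*} [Group Q] [Finite Q] {s p : ℕ} (hs : s.Prime)
    (hp : p.Prime) (hsp : s ≠ p)
    (hQ : IsPGroup p Q) (φ : Monoid.End Q) (hφ : φ ^ s = 1)
    (hmin : ∀ N : Subgroup Q, (∀ x ∈ N, φ x ∈ N) → N ≠ ⊤ → ∀ x ∈ N, φ x = x)
    (hne : ∃ x, φ x ≠ x)
    (N : Subgroup Q) (hN : N.Normal) (hNφ : ∀ x ∈ N, φ x ∈ N) (hNtop : N ≠ ⊤) :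
    N ≤ Subgroup.center Q := by
  have hfix := hmin N hNφ hNtop
  set C := Subgroup.centralizer (N : Set Q) with hC
  have hxC : ∀ x, x⁻¹ * φ x ∈ C := by
    intro x
    rw [hC, Subgroup.mem_centralizer_iff]
    intro n hn
    have h1 := hfix _ (hN.conj_mem n hn x)
    rw [map_mul, map_mul, map_inv, hfix n hn] at h1
    calc n * (x⁻¹ * φ x) = x⁻¹ * (x * n * x⁻¹) * φ x := by group
      _ = x⁻¹ * (φ x * n * (φ x)⁻¹) * φ x := by rw [h1]
      _ = x⁻¹ * φ x * n := by group
  have hCtop : C = ⊤ := by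
    by_contra hCt
    have hCφ : ∀ x ∈ C, φ x ∈ C := by
      intro x hx
      rw [hC, Subgroup.mem_centralizer_iff] at hx ⊢
      intro n hn
      have := congrArg φ (hx n hn)
      rwa [map_mul, map_mul, hfix n hn] at this
    have h1 := hmin C hCφ hCt
    obtain ⟨x, hx⟩ := hne
    exact hx (hh_fixed hs hp hsp hQ φ hφ x (h1 _ (hxC x)))
  intro n hn
  rw [Subgroup.mem_center_iff]
  intro x
  have hx : x ∈ C := by rw [hCtop]; trivial
  rw [hC, Subgroup.mem_centralizer_iff] at hx
  exact (hx n hn).symm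

theorem hh_minimal {T : Type*} [Group T] [Finite T] (φ : Monoid.End T) (hne : ∃ x, φ x ≠ x) :
    ∃ Q : Subgroup T, (∀ x ∈ Q, φ x ∈ Q) ∧ (∃ x ∈ Q, φ x ≠ x) ∧
      ∀ N : Subgroup T, N < Q → (∀ x ∈ N, φ x ∈ N) → ∀ x ∈ N, φ x = x := by
  have hwf : WellFounded (fun a b : Subgroup T => a < b) := wellFounded_lt
  obtain ⟨Q, ⟨h1, h2⟩, h3⟩ := hwf.has_min
    {Q : Subgroup T | (∀ x ∈ Q, φ x ∈ Q) ∧ (∃ x ∈ Q, φ x ≠ x)}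
    ⟨⊤, by simp, by simpa using hne⟩
  refine ⟨Q, h1, h2, ?_⟩
  intro N hN hNφ x hx
  by_contra h
  exact h3 N ⟨hNφ, x, hx, h⟩ hN

theorem hh_class2 {Q : Type*} [Group Q] [Finite Q] {s p : ℕ} (hs : s.Prime)
    (hp : p.Prime) (hsp : s ≠ p)
    (hQ : IsPGroup p Q) (φ : Monoid.End Q) (hφ : φ ^ s = 1)
    (hmin : ∀ N : Subgroup Q, (∀ x ∈ N, φ x ∈ N) → N ≠ ⊤ → ∀ x ∈ N, φ x = x)
    (hne : ∃ x, φ x ≠ x) (hnc : Subgroup.center Q ≠ ⊤) :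
    (∀ z ∈ Subgroup.center Q, φ z = z) ∧ (∀ x y : Q, x * y * x⁻¹ * y⁻¹ ∈ Subgroup.center Q) ∧
    (∀ x, x⁻¹ * φ x ∈ Subgroup.center Q → x ∈ Subgroup.center Q) := by
  have hb := hh_bij hs φ hφ
  have hZφ : ∀ x ∈ Subgroup.center Q, φ x ∈ Subgroup.center Q := by
    intro x hx
    rw [Subgroup.mem_center_iff] at hx ⊢
    intro y
    obtain ⟨y, rfl⟩ := hb.2 y
    rw [← map_mul, hx, map_mul]
  have hZ := hmin _ hZφ hnc
  have hcomm : ∀ x y : Q, x * y * x⁻¹ * y⁻¹ ∈ Subgroup.center Q := by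
    have hle : commutator Q ≤ Subgroup.center Q := by
      apply hh_normal_central hs hp hsp hQ φ hφ hmin hne
      · infer_instance
      · intro x hx
        let ψ : Q →* Q := φ
        have h1 : (commutator Q).map ψ ≤ commutator Q := by
          rw [commutator_def, Subgroup.map_commutator]
          exact Subgroup.commutator_mono le_top le_top
        exact h1 (Subgroup.mem_map_of_mem ψ hx)
      · intro h
        have : Fact p.Prime := ⟨hp⟩
        have hnil : Group.IsNilpotent Q := hQ.isNilpotent
        have hsol : Group.IsSolvable Q := inferInstance
        have hnt : Nontrivial Q := by
          obtain ⟨x, hx⟩ := hne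
          exact ⟨_, _, hx⟩
        exact absurd h (Group.IsSolvable.commutator_lt_top_of_nontrivial Q).ne
    intro x y
    exact hle (Subgroup.commutator_mem_commutator (Subgroup.mem_top x) (Subgroup.mem_top y))
  refine ⟨hZ, hcomm, ?_⟩
  let F : Subgroup Q := Subgroup.comap (QuotientGroup.mk' (Subgroup.center Q))
    (MonoidHom.eqLocus ((QuotientGroup.map (Subgroup.center Q) (Subgroup.center Q) φ hZφ))
      (MonoidHom.id _))
  have hF : ∀ x, x ∈ F ↔ x⁻¹ * φ x ∈ Subgroup.center Q := by
    intro x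
    rw [← QuotientGroup.eq]
    exact eq_comm
  have hle : F ≤ Subgroup.center Q := by
    apply hh_normal_central hs hp hsp hQ φ hφ hmin hne
    · constructor
      intro n hn y
      have h1 : y * n * y⁻¹ = (y * n * y⁻¹ * n⁻¹) * n := by simp
      rw [h1]
      apply F.mul_mem _ hn
      rw [hF]
      have := hcomm y n
      rw [hZ _ this, inv_mul_cancel]; exact one_mem _
    · intro x hx
      rw [hF] at hx ⊢
      rw [← map_inv, ← map_mul]
      exact hZφ _ hx
    · intro h
      obtain ⟨x, hx⟩ := hne
      have hx' : x ∈ F := by rw [h]; trivial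
      rw [hF] at hx'
      exact hx (hh_fixed hs hp hsp hQ φ hφ x (hZ _ hx'))
  intro x hx
  exact hle ((hF x).2 hx)

theorem hh_orbits {E K : Type*} [Fintype E] [Field K] (π : Equiv.Perm E) (s : ℕ) (hs : s.Prime)
    (hπ : π ^ s = 1) (e₀ : E) (h0 : ∀ e, π e = e ↔ e = e₀) (hnt : ∃ e, e ≠ e₀)
    (C : Submodule K (E → K)) (hC : ∀ a ∈ C, ∀ e, a (π e) = 0 ↔ a e = 0) :
    s * Module.finrank K C ≤ Fintype.card E + (s - 1) ∧ s ∣ Fintype.card E - 1 := by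
  classical
  let Γ := Subgroup.zpowers π
  have hπ1 : π ≠ 1 := by
    rintro rfl
    obtain ⟨e, he⟩ := hnt
    exact he ((h0 e).1 rfl)
  have hord : orderOf π = s := orderOf_eq_prime hπ hπ1 (hp := ⟨hs⟩)
  have hcardΓ : Fintype.card Γ = s := by rw [Fintype.card_zpowers, hord]
  have : Fact s.Prime := ⟨hs⟩
  have hB := MulAction.sum_card_fixedBy_eq_card_orbits_mul_card_group Γ E
  rw [hcardΓ] at hB
  have hfix : ∀ γ : Γ, γ ≠ 1 → Fintype.card (MulAction.fixedBy E γ) = 1 := by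
    intro γ hγ
    rw [Fintype.card_eq_one_iff]
    have he0 : ∀ γ : Γ, γ • e₀ = e₀ := by
      rintro ⟨_, n, rfl⟩
      show (π ^ n) e₀ = e₀
      have : Function.IsFixedPt π e₀ := (h0 e₀).2 rfl
      exact Equiv.Perm.zpow_apply_eq_self_of_apply_eq_self this n
    refine ⟨⟨e₀, he0 γ⟩, ?_⟩
    rintro ⟨e, he⟩
    apply Subtype.ext
    show e = e₀
    rw [← h0]
    have hmem : (⟨π, Subgroup.mem_zpowers π⟩ : Γ) ∈ Subgroup.zpowers γ := by
      apply mem_zpowers_of_prime_card (p := s) _ hγ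
      rw [Nat.card_eq_fintype_card, hcardΓ]
    obtain ⟨n, hn⟩ := hmem
    have h1 : (γ : Equiv.Perm E) e = e := he
    have h2 : ((γ : Equiv.Perm E) ^ n) e = e :=
      Equiv.Perm.zpow_apply_eq_self_of_apply_eq_self h1 n
    have h3 : (γ : Equiv.Perm E) ^ n = π := congrArg Subtype.val hn
    rwa [h3] at h2
  have hsum : ∑ γ : Γ, Fintype.card (MulAction.fixedBy E γ) = Fintype.card E + (s - 1) := by
    rw [← Finset.add_sum_erase _ _ (Finset.mem_univ (1 : Γ))]
    congr 1
    · apply Fintype.card_congr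
      exact (Equiv.subtypeUnivEquiv (fun e => one_smul Γ e))
    · rw [Finset.sum_congr rfl (fun γ hγ => hfix γ (Finset.ne_of_mem_erase hγ))]
      simp [Finset.card_erase_of_mem, hcardΓ]
  let Ω := Quotient (MulAction.orbitRel Γ E)
  have hle : Module.finrank K C ≤ Fintype.card Ω := by
    let F : C →ₗ[K] (Ω → K) :=
      { toFun := fun a ω => a.1 ω.out
        map_add' := fun a b => rfl
        map_smul' := fun c a => rfl }
    have hF : Function.Injective F := by
      rw [injective_iff_map_eq_zero]
      intro a ha
      apply Subtype.ext
      funext e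
      have h1 : a.1 (Quotient.mk (MulAction.orbitRel Γ E) e).out = 0 := congrFun ha _
      have h2 : (MulAction.orbitRel Γ E) (Quotient.mk (MulAction.orbitRel Γ E) e).out e :=
        Quotient.mk_out (s := MulAction.orbitRel Γ E) e
      obtain ⟨⟨_, n, rfl⟩, hn⟩ := h2
      have h3 : ∀ (n : ℤ) e, a.1 ((π ^ n) e) = 0 ↔ a.1 e = 0 := by
        intro n
        induction n using Int.induction_on with
        | zero => simp
        | succ i ih => intro e; rw [zpow_add, zpow_one, Equiv.Perm.mul_apply, ih, hC _ a.2]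
        | pred i ih =>
          intro e
          rw [sub_eq_add_neg, zpow_add, Equiv.Perm.mul_apply, ih, ← hC _ a.2]; simp
      have h4 : (π ^ n) e = (Quotient.mk (MulAction.orbitRel Γ E) e).out := hn
      rw [← h4, h3] at h1
      exact h1
    have := LinearMap.finrank_le_finrank_of_injective hF
    rwa [Module.finrank_fintype_fun_eq_card] at this
  rw [hsum] at hB
  have hpos := hs.pos
  have hEpos : 0 < Fintype.card E := Fintype.card_pos_iff.2 ⟨e₀⟩
  constructor
  · rw [hB, mul_comm]
    exact Nat.mul_le_mul_right _ hle
  · have h5 : Fintype.card E - 1 + s = Fintype.card Ω * s := by rw [← hB]; omega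
    have h6 : s ∣ Fintype.card E - 1 + s := by rw [h5]; exact dvd_mul_left _ _
    exact (Nat.dvd_add_left (dvd_refl s)).1 h6

theorem hh_rho_ne {K W Q : Type*} [Field K] [AddCommGroup W] [Module K W] [Nontrivial W]
    [Group Q] (ρ : Q →* Module.End K W) (x : Q) : ρ x ≠ 0 := by
  intro h
  have : ρ (x * x⁻¹) = 0 := by rw [map_mul, h, zero_mul]
  rw [mul_inv_cancel, map_one] at this
  exact one_ne_zero this

theorem hh_form {K W Q : Type*} [Field K] [AddCommGroup W] [Module K W] [Nontrivial W]
    [Group Q] (ρ : Q →* Module.End K W)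
    (hscal : ∀ z ∈ Subgroup.center Q, ∃ a : K, ρ z = a • 1)
    (hcomm : ∀ x y : Q, x * y * x⁻¹ * y⁻¹ ∈ Subgroup.center Q)
    (hrad : ∀ x, (∀ y, ρ (y * x) = ρ (x * y)) → x ∈ Subgroup.center Q) :
    ∃ χ : Q →* (Q →* K), (∀ x y, ρ y * ρ x = χ x y • (ρ x * ρ y)) ∧
      (∀ x, χ x = 1 ↔ x ∈ Subgroup.center Q) ∧
      (∀ y, (∀ x, χ x y = 1) ↔ y ∈ Subgroup.center Q) := by
  have h1 : ∀ x y, ∃ a : K, ρ y * ρ x = a • (ρ x * ρ y) := by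
    intro x y
    obtain ⟨a, ha⟩ := hscal _ (hcomm y x)
    refine ⟨a, ?_⟩
    have : ρ (y * x * y⁻¹ * x⁻¹) * (ρ x * ρ y) = ρ y * ρ x := by
      rw [← map_mul, ← map_mul, ← map_mul]; congr 1; group
    rw [← this, ha, smul_mul_assoc, one_mul]
  choose c hc using h1
  have huniq : ∀ (a b : K) x, a • ρ x = b • ρ x → a = b := by
    intro a b x h
    have : (a - b) • ρ x = 0 := by rw [sub_smul, h, sub_self]
    exact sub_eq_zero.1 ((smul_eq_zero.1 this).resolve_right (hh_rho_ne ρ x))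
  have hone : ∀ x y, ρ (y * x) = ρ (x * y) → c x y = 1 := by
    intro x y h
    apply huniq _ _ (x * y)
    rw [map_mul ρ x y, ← hc, one_smul, ← map_mul, ← map_mul, h]
  have hone' : ∀ x y, c x y = 1 → ρ (y * x) = ρ (x * y) := by
    intro x y h
    rw [map_mul, map_mul, hc, h, one_smul]
  let χ : Q →* (Q →* K) :=
    { toFun := fun x =>
        { toFun := c x
          map_one' := hone _ _ (by simp)
          map_mul' := by
            intro y z
            apply huniq _ _ (x * (y * z))
            have := hc x (y * z)
            rw [map_mul ρ x, ← this, map_mul, mul_assoc, hc x z, mul_smul_comm, ← mul_assoc, hc x y,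
              smul_mul_assoc, smul_smul, mul_comm (c x z), mul_assoc] }
      map_one' := by
        ext y
        exact hone _ _ (by simp)
      map_mul' := by
        intro x z
        ext y
        show c (x * z) y = c x y * c z y
        apply huniq _ _ (x * z * y)
        have := hc (x * z) y
        rw [map_mul ρ (x * z), ← this, map_mul, ← mul_assoc, hc x y, smul_mul_assoc, mul_assoc, hc z y,
          mul_smul_comm, smul_smul, mul_assoc] }
  have hχ : ∀ x y, χ x y = c x y := fun x y => rfl
  refine ⟨χ, fun x y => hc x y, ?_, ?_⟩
  · intro x
    constructor
    · intro h
      apply hrad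
      intro y
      exact hone' _ _ (by rw [← hχ, h]; rfl)
    · intro h
      ext y
      rw [hχ]
      exact hone _ _ (by rw [Subgroup.mem_center_iff.1 h y])
  · intro y
    constructor
    · intro h
      apply hrad
      intro x
      exact (hone' _ _ (h x)).symm
    · intro h x
      exact hone _ _ (by rw [Subgroup.mem_center_iff.1 h x])

theorem hh_conj_sum {K W Q : Type*} [Field K] [AddCommGroup W] [Module K W]
    [Group Q] [Fintype Q] (ρ : Q →* Module.End K W) (χ : Q →* (Q →* K))
    (h1 : ∀ x y, ρ y * ρ x = χ x y • (ρ x * ρ y))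
    (h2 : ∀ x, χ x = 1 ↔ x ∈ Subgroup.center Q) (x : Q) [Decidable (x ∈ Subgroup.center Q)] :
    ∑ y, ρ y * ρ x * ρ y⁻¹ = if x ∈ Subgroup.center Q then (Fintype.card Q : K) • ρ x else 0 := by
  classical
  have h3 : ∀ y, ρ y * ρ x * ρ y⁻¹ = χ x y • ρ x := by
    intro y
    rw [h1, smul_mul_assoc, mul_assoc, ← map_mul ρ y, mul_inv_cancel, map_one, mul_one]
  simp_rw [h3]
  rw [← Finset.sum_smul]
  split_ifs with hx
  · rw [(h2 x).2 hx]; simp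
  · rw [sum_hom_units_eq_zero _ (fun h => hx ((h2 x).1 h)), zero_smul]

theorem hh_schur {K W Q : Type*} [Field K] [IsAlgClosed K] [AddCommGroup W] [Module K W]
    [FiniteDimensional K W] [Nontrivial W] [Group Q] (ρ : Q →* Module.End K W)
    (G : Module.End K W)
    (hirr : ∀ S : Submodule K W, (∀ x, ∀ w ∈ S, ρ x w ∈ S) → (∀ w ∈ S, G w ∈ S) → S = ⊥ ∨ S = ⊤)
    (B : Module.End K W) (hB : ∀ x, B * ρ x = ρ x * B) (hBG : B * G = G * B) :
    ∃ c : K, B = c • 1 := by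
  obtain ⟨c, hc⟩ := Module.End.exists_eigenvalue B
  refine ⟨c, ?_⟩
  have hinv : ∀ D : Module.End K W, B * D = D * B → ∀ w ∈ B.eigenspace c, D w ∈ B.eigenspace c := by
    intro D hD w hw
    rw [Module.End.mem_eigenspace_iff] at hw ⊢
    have := LinearMap.congr_fun hD w
    simp only [Module.End.mul_apply] at this
    rw [this, hw, map_smul]
  rcases hirr (B.eigenspace c) (fun x => hinv _ (hB x)) (hinv _ hBG) with h | h
  · exact absurd h hc
  · ext w
    have : w ∈ B.eigenspace c := by rw [h]; trivial
    rw [Module.End.mem_eigenspace_iff] at this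
    simpa using this

theorem hh_commutant {K W Q : Type*} [Field K] [IsAlgClosed K] [AddCommGroup W] [Module K W]
    [FiniteDimensional K W] [Nontrivial W] [Group Q] [Fintype Q] (ρ : Q →* Module.End K W)
    (hcard : (Nat.card Q : K) ≠ 0)
    (χ : Q →* (Q →* K))
    (h1 : ∀ x y, ρ y * ρ x = χ x y • (ρ x * ρ y))
    (h2 : ∀ x, χ x = 1 ↔ x ∈ Subgroup.center Q)
    (s : ℕ) (hs : s.Prime) (φ : Monoid.End Q) (hφ : φ ^ s = 1)
    (G : Module.End K W) (hG : G ^ s = 1) (hGρ : ∀ x, G * ρ x = ρ (φ x) * G)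
    (hZ : ∀ z ∈ Subgroup.center Q, φ z = z)
    (hfpf : ∀ x, x⁻¹ * φ x ∈ Subgroup.center Q → x ∈ Subgroup.center Q)
    (hirr : ∀ S : Submodule K W, (∀ x, ∀ w ∈ S, ρ x w ∈ S) → (∀ w ∈ S, G w ∈ S) → S = ⊥ ∨ S = ⊤)
    (B : Module.End K W) (hB : ∀ x, B * ρ x = ρ x * B) :
    ∃ c : K, B = c • 1 := by
  classical
  have hbij := hh_bij hs φ hφ
  have hcardZ : (Nat.card (Subgroup.center Q) : K) ≠ 0 := by
    intro h
    obtain ⟨m, hm⟩ := Subgroup.card_subgroup_dvd_card (Subgroup.center Q)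
    apply hcard
    rw [hm, Nat.cast_mul, h, zero_mul]
  set U : Module.End K W := ∑ x, ρ x * G * ρ x⁻¹ with hU
  set a : Module.End K W := ∑ x, ρ (x * (φ x)⁻¹) with ha
  have hUa : U = a * G := by
    rw [hU, ha, Finset.sum_mul]
    refine Finset.sum_congr rfl fun x _ => ?_
    rw [mul_assoc, hGρ, map_inv, ← mul_assoc, ← map_mul]
  have hUρ : ∀ y, U * ρ y = ρ y * U := by
    intro y
    rw [hU, Finset.sum_mul, Finset.mul_sum]
    symm
    apply Fintype.sum_equiv (Equiv.mulLeft y)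
    intro x
    simp only [Equiv.coe_mulLeft, mul_inv_rev, map_mul]
    rw [mul_assoc (_ * _ * G), mul_assoc (ρ x⁻¹), ← map_mul ρ y⁻¹, inv_mul_cancel, map_one, mul_one,
      mul_assoc, mul_assoc, mul_assoc]
  have hUG : U * G = G * U := by
    rw [hU, Finset.sum_mul, Finset.mul_sum]
    symm
    apply Fintype.sum_equiv (Equiv.ofBijective φ hbij)
    intro x
    simp only [Equiv.ofBijective_apply]
    rw [← map_inv, ← mul_assoc, ← mul_assoc, hGρ, mul_assoc (ρ (φ x) * G) (ρ (φ x⁻¹)) G, ← hGρ x⁻¹,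
      ← mul_assoc]
  obtain ⟨u, hu⟩ := hh_schur ρ G hirr U hUρ hUG
  have hGinv : G * G ^ (s - 1) = 1 := by
    rw [← pow_succ', Nat.sub_add_cancel hs.one_le, hG]
  have ha0 : a ≠ 0 := by
    intro h0
    have hs1 : ∑ y, ρ y * a * ρ y⁻¹ = 0 := by simp [h0]
    have hs2 : ∑ y, ρ y * a * ρ y⁻¹ = ∑ x, ∑ y, ρ y * ρ (x * (φ x)⁻¹) * ρ y⁻¹ := by
      rw [Finset.sum_comm]
      refine Finset.sum_congr rfl fun y _ => ?_
      rw [ha, Finset.mul_sum, Finset.sum_mul]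
    have hs3 : ∀ x, ∑ y, ρ y * ρ (x * (φ x)⁻¹) * ρ y⁻¹ =
        if x ∈ Subgroup.center Q then (Fintype.card Q : K) • 1 else 0 := by
      intro x
      rw [hh_conj_sum ρ χ h1 h2]
      have hiff : x * (φ x)⁻¹ ∈ Subgroup.center Q ↔ x ∈ Subgroup.center Q := by
        constructor
        · intro h
          apply hfpf
          have h5 := (Subgroup.center Q).inv_mem h
          rw [mul_inv_rev, inv_inv] at h5
          have h6 := Subgroup.mem_center_iff.1 h5 x⁻¹
          have h7 : x⁻¹ * φ x = φ x * x⁻¹ := by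
            calc x⁻¹ * φ x = x⁻¹ * (φ x * x⁻¹) * x := by group
              _ = φ x * x⁻¹ := by rw [h6]; group
          rw [h7]; exact h5
        · intro h
          rw [hZ x h, mul_inv_cancel]; exact one_mem _
      by_cases hx : x ∈ Subgroup.center Q
      · rw [if_pos (hiff.2 hx), if_pos hx, hZ x hx, mul_inv_cancel, map_one]
      · rw [if_neg (fun h => hx (hiff.1 h)), if_neg hx]
    rw [hs1] at hs2
    simp_rw [hs3] at hs2
    rw [← Finset.sum_filter, Finset.sum_const, ← Nat.cast_smul_eq_nsmul K, smul_smul] at hs2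
    have hcz : (Finset.univ.filter (fun x => x ∈ Subgroup.center Q)).card =
        Nat.card (Subgroup.center Q) := by
      rw [Nat.card_eq_fintype_card, Fintype.card_subtype]
    rw [hcz, ← Nat.card_eq_fintype_card] at hs2
    exact (smul_ne_zero (mul_ne_zero hcardZ hcard) one_ne_zero) hs2.symm
  have hu0 : u ≠ 0 := by
    rintro rfl
    apply ha0
    rw [zero_smul] at hu
    calc a = a * (G * G ^ (s - 1)) := by rw [hGinv, mul_one]
      _ = 0 := by rw [← mul_assoc, ← hUa, hu, zero_mul]
  have haU : a * G = u • 1 := by rw [← hUa, hu]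
  have hBa : B * a = a * B := by
    rw [ha, Finset.mul_sum, Finset.sum_mul]
    exact Finset.sum_congr rfl fun x _ => hB _
  -- `a = u G⁻¹`
  have haG : G * a = u • 1 := by
    have e : a = u • G ^ (s - 1) := by
      calc a = a * (G * G ^ (s - 1)) := by rw [hGinv, mul_one]
        _ = u • G ^ (s - 1) := by rw [← mul_assoc, haU, smul_mul_assoc, one_mul]
    rw [e, mul_smul_comm, hGinv]
  have hBG : B * G = G * B := by
    have e1 : u • (B * G) = u • (G * B) := by
      calc u • (B * G) = (G * a) * (B * G) := by rw [haG, smul_mul_assoc, one_mul]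
        _ = G * (B * (a * G)) := by rw [mul_assoc, ← mul_assoc a, ← hBa, mul_assoc B]
        _ = u • (G * B) := by rw [haU, mul_smul_comm, mul_smul_comm, mul_one]
    exact smul_right_injective _ hu0 e1
  exact hh_schur ρ G hirr B hB hBG

theorem hh_span {K W Q : Type*} [Field K] [AddCommGroup W] [Module K W]
    [Group Q] [Fintype Q] (ρ : Q →* Module.End K W)
    (hcard : (Nat.card Q : K) ≠ 0)
    (χ : Q →* (Q →* K))
    (h1 : ∀ x y, ρ y * ρ x = χ x y • (ρ x * ρ y))
    (h3 : ∀ y, (∀ x, χ x y = 1) ↔ y ∈ Subgroup.center Q)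
    (hscal : ∀ z ∈ Subgroup.center Q, ∃ a : K, ρ z = a • 1)
    (hcom : ∀ B : Module.End K W, (∀ x, B * ρ x = ρ x * B) → ∃ c : K, B = c • 1)
    (B : Module.End K W) : B ∈ Submodule.span K (Set.range ρ) := by
  classical
  have hcardZ : (Nat.card (Subgroup.center Q) : K) ≠ 0 := by
    intro h
    obtain ⟨m, hm⟩ := Subgroup.card_subgroup_dvd_card (Subgroup.center Q)
    apply hcard
    rw [hm, Nat.cast_mul, h, zero_mul]
  let D : Q → Module.End K W := fun x => ∑ y, χ x y⁻¹ • (ρ y * B * ρ y⁻¹)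
  have hχinv : ∀ x y, χ x y * χ x y⁻¹ = 1 := by
    intro x y; rw [← map_mul, mul_inv_cancel, map_one]
  have hχinv' : ∀ x y, χ x y * χ x⁻¹ y = 1 := by
    intro x y
    rw [← MonoidHom.mul_apply, ← map_mul, mul_inv_cancel, map_one]; rfl
  have hD : ∀ x w, ρ w * D x = χ x w • (D x * ρ w) := by
    intro x w
    simp only [D]
    rw [Finset.mul_sum, Finset.sum_mul, Finset.smul_sum]
    apply Fintype.sum_equiv (Equiv.mulLeft w)
    intro y
    simp only [Equiv.coe_mulLeft, mul_inv_rev, map_mul, smul_mul_assoc, mul_smul_comm, smul_smul]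
    have e1 : χ x w * (χ x y⁻¹ * χ x w⁻¹) = χ x y⁻¹ := by
      rw [mul_comm (χ x y⁻¹), ← mul_assoc, hχinv, one_mul]
    rw [e1]
    congr 1
    rw [mul_assoc (_ * _ * B), mul_assoc (ρ y⁻¹), ← map_mul ρ w⁻¹, inv_mul_cancel, map_one, mul_one,
      mul_assoc, mul_assoc, mul_assoc]
  have hDmem : ∀ x, D x ∈ Submodule.span K (Set.range ρ) := by
    intro x
    obtain ⟨c, hc⟩ := hcom (D x * ρ x⁻¹) (by
      intro w
      rw [← mul_assoc (ρ w), hD, smul_mul_assoc, mul_assoc (D x), mul_assoc (D x), h1 x⁻¹ w,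
        mul_smul_comm, smul_smul, hχinv', one_smul])
    have : D x = c • ρ x := by
      calc D x = D x * ρ x⁻¹ * ρ x := by rw [mul_assoc, ← map_mul, inv_mul_cancel, map_one, mul_one]
        _ = c • ρ x := by rw [hc, smul_mul_assoc, one_mul]
    rw [this]
    exact Submodule.smul_mem _ _ (Submodule.subset_span ⟨x, rfl⟩)
  have hsum : ∑ x, D x = ((Nat.card (Subgroup.center Q) : K) * (Nat.card Q : K)) • B := by
    simp only [D]
    rw [Finset.sum_comm]
    have hin : ∀ y, ∑ x, χ x y⁻¹ • (ρ y * B * ρ y⁻¹) =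
        if y ∈ Subgroup.center Q then (Nat.card Q : K) • B else 0 := by
      intro y
      rw [← Finset.sum_smul]
      by_cases hy : y ∈ Subgroup.center Q
      · rw [if_pos hy]
        have hy' := (h3 y⁻¹).2 (inv_mem hy)
        obtain ⟨c, hc⟩ := hscal y hy
        have : ρ y * B * ρ y⁻¹ = B := by
          have e : ρ y * B = B * ρ y := by rw [hc]; simp
          rw [e, mul_assoc, ← map_mul, mul_inv_cancel, map_one, mul_one]
        rw [this]
        simp [hy']
      · rw [if_neg hy]
        let ψ : Q →* K :=
          { toFun := fun x => χ x y⁻¹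
            map_one' := by rw [map_one]; rfl
            map_mul' := by intro a b; rw [map_mul]; rfl }
        have hψ : ψ ≠ 1 := by
          intro h
          apply hy
          rw [← inv_mem_iff]
          rw [← h3]
          intro x
          exact DFunLike.congr_fun h x
        have := sum_hom_units_eq_zero ψ hψ
        have e : ∑ x, χ x y⁻¹ = 0 := this
        rw [e, zero_smul]
    simp_rw [hin]
    rw [← Finset.sum_filter, Finset.sum_const, ← Nat.cast_smul_eq_nsmul K, smul_smul]
    congr 3
    rw [Nat.card_eq_fintype_card, Fintype.card_subtype]
  have hmem : ((Nat.card (Subgroup.center Q) : K) * (Nat.card Q : K)) • B ∈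
      Submodule.span K (Set.range ρ) := by
    rw [← hsum]
    exact Submodule.sum_mem _ fun x _ => hDmem x
  exact (Submodule.smul_mem_iff _ (mul_ne_zero hcardZ hcard)).1 hmem

theorem hh_irred {K W Q : Type*} [Field K] [IsAlgClosed K] [AddCommGroup W] [Module K W]
    [FiniteDimensional K W] [Nontrivial W] [Group Q] [Fintype Q] (ρ : Q →* Module.End K W)
    (hcard : (Nat.card Q : K) ≠ 0)
    (s : ℕ) (hs : s.Prime) (φ : Monoid.End Q) (hφ : φ ^ s = 1)
    (G : Module.End K W) (hG : G ^ s = 1) (hGρ : ∀ x, G * ρ x = ρ (φ x) * G)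
    (hZ : ∀ z ∈ Subgroup.center Q, φ z = z)
    (hcomm : ∀ x y : Q, x * y * x⁻¹ * y⁻¹ ∈ Subgroup.center Q)
    (hfpf : ∀ x, x⁻¹ * φ x ∈ Subgroup.center Q → x ∈ Subgroup.center Q)
    (hrad : ∀ x, (∀ y, ρ (y * x) = ρ (x * y)) → x ∈ Subgroup.center Q)
    (hnc : Subgroup.center Q ≠ ⊤)
    (hirr : ∀ S : Submodule K W, (∀ x, ∀ w ∈ S, ρ x w ∈ S) → (∀ w ∈ S, G w ∈ S) → S = ⊥ ∨ S = ⊤)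
    (f : K[X]) (hf0 : f ≠ 0) (hfn : f.natDegree < s) (hf : aeval G f = 0) :
    ∃ n : ℕ, n ^ 2 = Nat.card (Q ⧸ Subgroup.center Q) ∧ n ≤ s - 1 ∧ s ∣ n ^ 2 - 1 := by
  classical
  have hbij := hh_bij hs φ hφ
  have hscal : ∀ z ∈ Subgroup.center Q, ∃ a : K, ρ z = a • 1 := by
    intro z hz
    apply hh_schur ρ G hirr
    · intro x
      rw [← map_mul, ← map_mul, Subgroup.mem_center_iff.1 hz x]
    · rw [hGρ, hZ z hz]
  obtain ⟨χ, h1, h2, h3⟩ := hh_form ρ hscal hcomm hrad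
  have hcom := hh_commutant ρ hcard χ h1 h2 s hs φ hφ G hG hGρ hZ hfpf hirr
  have hspan := hh_span ρ hcard χ h1 h3 hscal hcom
  let E := Q ⧸ Subgroup.center Q
  let o : E → Q := fun e => e.out
  have ho : ∀ e : E, (QuotientGroup.mk (o e) : E) = e := fun e => Quotient.out_eq' e
  have hrho : ∀ x y : Q, (QuotientGroup.mk x : E) = QuotientGroup.mk y →
      ∃ m : K, m ≠ 0 ∧ ρ x = m • ρ y := by
    intro x y hxy
    obtain ⟨m, hm⟩ := hscal _ (QuotientGroup.eq.1 hxy.symm)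
    have e : ρ x = m • ρ y := by
      calc ρ x = ρ y * ρ (y⁻¹ * x) := by rw [← map_mul]; congr 1; group
        _ = m • ρ y := by rw [hm, mul_smul_comm, mul_one]
    refine ⟨m, ?_, e⟩
    rintro rfl
    exact hh_rho_ne ρ x (by rw [e, zero_smul])
  let b : E → Module.End K W := fun e => ρ (o e)
  have hLI : LinearIndependent K b := by
    apply hh_charIndep (fun e => χ (o e)) _
      (fun y => LinearMap.mulLeft K (ρ y) ∘ₗ LinearMap.mulRight K (ρ y⁻¹)) b
      (fun e => hh_rho_ne ρ _)
    · intro y e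
      simp only [LinearMap.comp_apply, LinearMap.mulLeft_apply, LinearMap.mulRight_apply, b]
      rw [← mul_assoc, h1, smul_mul_assoc, mul_assoc, ← map_mul ρ y, mul_inv_cancel, map_one, mul_one]
    · intro e e' h
      rw [← ho e, ← ho e', QuotientGroup.eq, ← h2, map_mul]
      have h' : χ (o e) = χ (o e') := h
      rw [← h', ← map_mul, inv_mul_cancel, map_one]
  have hsp : ⊤ ≤ Submodule.span K (Set.range b) := by
    intro B _
    refine Submodule.span_le.2 ?_ (hspan B)
    rintro _ ⟨x, rfl⟩
    obtain ⟨m, -, hm⟩ := hrho x (o (QuotientGroup.mk x)) (ho _).symm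
    show ρ x ∈ Submodule.span K (Set.range b)
    rw [hm]
    exact Submodule.smul_mem _ _ (Submodule.subset_span ⟨_, rfl⟩)
  let β := Module.Basis.mk hLI hsp
  have hβ : ∀ e, β e = ρ (o e) := fun e => Module.Basis.mk_apply hLI hsp e
  have hdim : Module.finrank K W ^ 2 = Fintype.card E := by
    have := Module.finrank_eq_card_basis β
    rw [← this, Module.finrank_linearMap, pow_two]
  have hZφ : Subgroup.center Q ≤ (Subgroup.center Q).comap (φ : Q →* Q) := by
    intro z hz
    show φ z ∈ Subgroup.center Q
    rw [hZ z hz]; exact hz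
  let πh : E →* E := QuotientGroup.map _ _ (φ : Q →* Q) hZφ
  have hπh : ∀ x : Q, πh (QuotientGroup.mk x) = QuotientGroup.mk (φ x) := fun x => rfl
  have hπs : ∀ (i : ℕ) (x : Q), πh^[i] (QuotientGroup.mk x) = QuotientGroup.mk ((φ ^ i) x) := by
    intro i
    induction i with
    | zero => intro x; rfl
    | succ i ih =>
      intro x
      rw [Function.iterate_succ_apply, hπh, ih, pow_succ]; rfl
  have hπsurj : Function.Surjective πh := by
    intro e
    obtain ⟨x, hx⟩ := hbij.2 (o e)
    exact ⟨QuotientGroup.mk x, by rw [hπh, hx, ho]⟩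
  let π : Equiv.Perm E := Equiv.ofBijective πh (Finite.surjective_iff_bijective.1 hπsurj)
  have hππ : ∀ e, π e = πh e := fun e => rfl
  have hπpow : π ^ s = 1 := by
    ext e
    rw [← Equiv.Perm.iterate_eq_pow]
    show πh^[s] e = e
    rw [← ho e, hπs, hφ]; rfl
  have hπfix : ∀ e, π e = e ↔ e = 1 := by
    intro e
    constructor
    · intro h
      rw [hππ, ← ho e, hπh] at h
      have h5 := hfpf _ (QuotientGroup.eq.1 h.symm)
      rw [← ho e]
      exact (QuotientGroup.eq_one_iff _).2 h5
    · rintro rfl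
      exact map_one πh
  have hnt : ∃ e : E, e ≠ 1 := by
    by_contra! h
    apply hnc
    rw [Subgroup.eq_top_iff']
    intro x
    exact (QuotientGroup.eq_one_iff x).1 (h x)
  let Cent := Subalgebra.toSubmodule (Subalgebra.centralizer K {G})
  let R : Module.End K W ≃ₗ[K] (E → K) := β.equivFun
  have hGinv : G * G ^ (s - 1) = 1 := by
    rw [← pow_succ', Nat.sub_add_cancel hs.one_le, hG]
  have hC : ∀ a ∈ Cent.map (R : Module.End K W →ₗ[K] (E → K)), ∀ e, a (π e) = 0 ↔ a e = 0 := by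
    rintro _ ⟨B, hB, rfl⟩ e
    have hBG : G * B = B * G := by
      have := (Subalgebra.mem_centralizer_iff K).1 hB G rfl
      exact this
    have hm : ∀ e, ∃ m : K, m ≠ 0 ∧ ρ (φ (o e)) = m • β (π e) := by
      intro e
      rw [hβ]
      apply hrho
      rw [ho, hππ, ← hπh, ho]
    choose m hm0 hm using hm
    have hsum : B = ∑ e, (R B e * m e) • β (π e) := by
      have e1 : B = ∑ e, R B e • β e := (β.sum_equivFun B).symm
      have e2 : B * G = (∑ e, (R B e * m e) • β (π e)) * G := by
        calc B * G = G * ∑ e, R B e • β e := by rw [← e1, hBG]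
          _ = _ := by
            rw [Finset.mul_sum, Finset.sum_mul]
            refine Finset.sum_congr rfl fun e _ => ?_
            rw [mul_smul_comm, hβ e, hGρ, hm, smul_mul_assoc, smul_mul_assoc, smul_smul]
      calc B = B * G * G ^ (s - 1) := by rw [mul_assoc, hGinv, mul_one]
        _ = _ := by rw [e2, mul_assoc, hGinv, mul_one]
    have hcoef : R B (π e) = R B e * m e := by
      have e3 := congrArg (fun D => R D (π e)) hsum
      simp only [map_sum, map_smul, Finset.sum_apply, Pi.smul_apply] at e3
      rw [e3, Finset.sum_eq_single e]
      · simp [R, Module.Basis.equivFun_self]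
      · intro e' _ hne
        simp [R, Module.Basis.equivFun_self, hne]
      · simp
    show R B (π e) = 0 ↔ R B e = 0
    rw [hcoef, mul_eq_zero]
    simp [hm0]
  obtain ⟨hle, hdvd⟩ := hh_orbits π s hs hπpow 1 hπfix hnt _ hC
  have hfr : Module.finrank K (Cent.map (R : Module.End K W →ₗ[K] (E → K))) =
      Module.finrank K (Subalgebra.centralizer K {G}) :=
    LinearEquiv.finrank_map_eq R Cent
  rw [hfr] at hle
  have hcent := hh_cent f.natDegree W G f hf0 rfl hf
  refine ⟨Module.finrank K W, by rw [hdim, Nat.card_eq_fintype_card], ?_, by rw [hdim]; exact hdvd⟩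
  set n := Module.finrank K W
  set c := Module.finrank K (Subalgebra.centralizer K {G})
  rw [← hdim] at hle
  obtain ⟨r, rfl⟩ : ∃ r, s = r + 1 := ⟨s - 1, (Nat.sub_add_cancel hs.one_le).symm⟩
  simp only [Nat.add_sub_cancel] at hle ⊢
  have h5 : n ^ 2 ≤ r * c := hcent.trans (Nat.mul_le_mul_right _ (by omega))
  have h6 : n ^ 2 ≤ r ^ 2 := by nlinarith
  exact (Nat.pow_le_pow_iff_left two_ne_zero).1 h6

theorem hh_arith {s p n m : ℕ} (hs : s.Prime) (hp : p.Prime) (hn : n ^ 2 = p ^ m)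
    (hn1 : 1 < n ^ 2) (hle : n ≤ s - 1) (hdvd : s ∣ n ^ 2 - 1) :
    p = 2 ∧ ∃ δ : ℕ, s = 2 ^ (2 ^ δ) + 1 := by
  have hn2 : 1 < n := by
    by_contra h
    have : n = 0 ∨ n = 1 := by omega
    rcases this with rfl | rfl <;> simp at hn1
  have hs2 := hs.two_le
  have e : n ^ 2 - 1 = (n + 1) * (n - 1) := by simpa using Nat.sq_sub_sq n 1
  rw [e, hs.dvd_mul] at hdvd
  have hsn : s = n + 1 := by
    rcases hdvd with h | h
    · have := Nat.le_of_dvd (by omega) h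
      omega
    · have := Nat.le_of_dvd (by omega) h
      omega
  obtain ⟨d, -, hd⟩ := (Nat.dvd_prime_pow hp).1 (show n ∣ p ^ m by rw [← hn]; exact dvd_pow_self n two_ne_zero)
  have hd0 : d ≠ 0 := by rintro rfl; simp at hd; omega
  have hp2 : p = 2 := by
    rcases hp.eq_two_or_odd' with h | h
    · exact h
    · exfalso
      have h1 : Odd n := by rw [hd]; exact h.pow
      have h2 : Even s := by rw [hsn]; exact h1.add_one
      have h3 := (hs.even_iff).1 h2
      omega
  subst hp2
  refine ⟨rfl, ?_⟩
  rw [hsn, hd] at hs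
  obtain ⟨δ, hδ⟩ := (Nat.pow_of_pow_add_prime (by norm_num) hd0 hs)
  exact ⟨δ, by rw [hsn, hd, hδ]⟩

theorem hh_restrict {T : Type*} [Group T] (φ : Monoid.End T) (s : ℕ) (hφ : φ ^ s = 1)
    (A : Subgroup T) (hA : ∀ x ∈ A, φ x ∈ A) :
    ∃ ψ : Monoid.End A, (∀ x, (ψ x : T) = φ x) ∧ ψ ^ s = 1 := by
  let ψ : A →* A := ((φ : T →* T).comp A.subtype).codRestrict A (fun x => hA x x.2)
  let ψ' : Monoid.End A := ψ
  have h1 : ∀ x, (ψ' x : T) = φ x := fun x => rfl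
  refine ⟨ψ', h1, ?_⟩
  have h2 : ∀ (i : ℕ) x, ((ψ' ^ i) x : T) = (φ ^ i) x := by
    intro i
    induction i with
    | zero => intro x; rfl
    | succ i ih =>
      intro x
      rw [pow_succ', pow_succ']
      show ((ψ' ((ψ' ^ i) x) : A) : T) = φ ((φ ^ i) x)
      rw [h1, ih]
  refine MonoidHom.ext fun x => Subtype.ext ((h2 s x).trans ?_)
  rw [hφ]; rfl

theorem hh_card_ne {Q K : Type*} [Group Q] [Finite Q] [Field K] {p : ℕ} (hp : p.Prime)
    (hQ : IsPGroup p Q) (hpK : (p : K) ≠ 0) : (Nat.card Q : K) ≠ 0 := by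
  have : Fact p.Prime := ⟨hp⟩
  obtain ⟨m, hm⟩ := IsPGroup.iff_card.1 hQ
  rw [hm, Nat.cast_pow]
  exact pow_ne_zero _ hpK

theorem hh_eig {K V Q : Type*} [Field K] [IsAlgClosed K] [AddCommGroup V] [Module K V]
    [FiniteDimensional K V] [Group Q] [Finite Q] (hcard : (Nat.card Q : K) ≠ 0)
    (ρ : Q →* Module.End K V) (z : Q) (hz : ρ z ≠ 1) :
    ∃ c : K, c ≠ 1 ∧ (ρ z).eigenspace c ≠ ⊥ := by
  have hss : (ρ z).IsSemisimple := by
    apply Module.End.isSemisimple_of_squarefree_aeval_eq_zero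
      (p := (X ^ Nat.card Q - 1 : K[X]))
    · exact (X_pow_sub_one_separable_iff.2 hcard).squarefree
    · rw [map_sub, map_pow, aeval_X, map_one, ← map_pow, pow_card_eq_one', map_one, sub_self]
  by_contra! h
  apply hz
  have htop : (⊤ : Submodule K V) ≤ (ρ z).eigenspace 1 := by
    rw [← hss.iSup_eigenspace_eq_top]
    refine iSup_le fun c => ?_
    by_cases hc : c = 1
    · rw [hc]
    · rw [h c hc]; exact bot_le
  ext v
  have := Module.End.mem_eigenspace_iff.1 (htop (Submodule.mem_top (x := v)))
  simpa using this

theorem hh_aeval_restrict {K V : Type*} [Field K] [AddCommGroup V] [Module K V]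
    (g : Module.End K V) (W : Submodule K V) (g' : Module.End K W) (hg : ∀ x, (g' x : V) = g x)
    (q : K[X]) (x : W) : ((aeval g' q) x : V) = aeval g q x := by
  induction q using Polynomial.induction_on' with
  | add p q hp hq => simp [hp, hq]
  | monomial m c =>
    simp only [aeval_monomial, Module.End.mul_apply, Module.algebraMap_end_apply,
      Submodule.coe_smul]
    congr 1
    induction m generalizing x with
    | zero => simp
    | succ m ihm => rw [pow_succ, pow_succ, Module.End.mul_apply, Module.End.mul_apply, ihm, hg]

theorem hh_minQ {K V Q : Type*} [Field K] [IsAlgClosed K] [AddCommGroup V] [Module K V]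
    [FiniteDimensional K V] [Group Q] [Finite Q] {s p : ℕ} (hs : s.Prime)
    (hp : p.Prime) (hsp : s ≠ p) (hQ : IsPGroup p Q) (hpK : (p : K) ≠ 0)
    (ρ : Q →* Module.End K V) (hρ : Function.Injective ρ)
    (φ : Monoid.End Q) (hφ : φ ^ s = 1) (G : Module.End K V) (hG : G ^ s = 1)
    (hGρ : ∀ x, G * ρ x = ρ (φ x) * G)
    (f : K[X]) (hf0 : f ≠ 0) (hfn : f.natDegree < s) (hf : aeval G f = 0)
    (hmin : ∀ N : Subgroup Q, (∀ x ∈ N, φ x ∈ N) → N ≠ ⊤ → ∀ x ∈ N, φ x = x)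
    (hne : ∃ x, φ x ≠ x) :
    p = 2 ∧ ∃ δ : ℕ, s = 2 ^ (2 ^ δ) + 1 := by
  classical
  have : Fintype Q := Fintype.ofFinite Q
  have hcard := hh_card_ne (K := K) hp hQ hpK
  have hnc : Subgroup.center Q ≠ ⊤ := by
    intro h
    obtain ⟨x, hx⟩ := hne
    apply hx
    apply hρ
    refine hh_abelian ?_ hcard ρ s hs φ hφ G hG hGρ f hf0 hfn hf x
    intro x y
    have hy : y ∈ Subgroup.center Q := by rw [h]; trivial
    exact Subgroup.mem_center_iff.1 hy x
  obtain ⟨hZ, hcomm, hfpf⟩ := hh_class2 hs hp hsp hQ φ hφ hmin hne hnc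
  have hxy : ∃ x y : Q, y * x ≠ x * y := by
    by_contra! h
    apply hnc
    rw [Subgroup.eq_top_iff']
    intro x
    rw [Subgroup.mem_center_iff]
    exact fun y => h x y
  obtain ⟨x₀, y₀, hxy⟩ := hxy
  set z := y₀ * x₀ * y₀⁻¹ * x₀⁻¹ with hz
  have hzc : z ∈ Subgroup.center Q := hcomm _ _
  have hzmul : y₀ * x₀ = z * (x₀ * y₀) := by rw [hz]; group
  have hz1 : ρ z ≠ 1 := by
    intro h
    rw [← map_one ρ] at h
    have := hρ h
    rw [this, one_mul] at hzmul
    exact hxy hzmul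
  obtain ⟨c, hc1, hcV⟩ := hh_eig hcard ρ z hz1
  have hcomz : ∀ x, ρ x * ρ z = ρ z * ρ x := by
    intro x
    rw [← map_mul, ← map_mul, Subgroup.mem_center_iff.1 hzc x]
  have hcomG : G * ρ z = ρ z * G := by rw [hGρ, hZ z hzc]
  have hinv : ∀ D : Module.End K V, D * ρ z = ρ z * D →
      ∀ w ∈ (ρ z).eigenspace c, D w ∈ (ρ z).eigenspace c := by
    intro D hD w hw
    rw [Module.End.mem_eigenspace_iff] at hw ⊢
    have := LinearMap.congr_fun hD w
    simp only [Module.End.mul_apply] at this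
    rw [← this, hw, map_smul]
  have hwf : WellFounded (fun a b : Submodule K V => a < b) := wellFounded_lt
  obtain ⟨W, ⟨hW0, hWe, hWρ, hWG⟩, hWmin⟩ := hwf.has_min
    {S : Submodule K V | S ≠ ⊥ ∧ S ≤ (ρ z).eigenspace c ∧ (∀ x, ∀ w ∈ S, ρ x w ∈ S) ∧
      (∀ w ∈ S, G w ∈ S)}
    ⟨(ρ z).eigenspace c, hcV, le_rfl, fun x => hinv _ (hcomz x), hinv _ hcomG⟩
  have hWnt : Nontrivial W := Submodule.nontrivial_iff_ne_bot.2 hW0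
  let ρW : Q →* Module.End K W :=
    { toFun := fun x => (ρ x).restrict (hWρ x)
      map_one' := by ext w; simp
      map_mul' := by intro x y; ext w; simp }
  have hρW : ∀ x w, (ρW x w : V) = ρ x w := fun x w => rfl
  let GW : Module.End K W := G.restrict hWG
  have hGW : ∀ w, (GW w : V) = G w := fun w => rfl
  have hGWpow : ∀ (i : ℕ) w, ((GW ^ i) w : V) = (G ^ i) w := by
    intro i w
    have := hh_aeval_restrict G W GW hGW (X ^ i) w
    simpa only [map_pow, aeval_X] using this
  have hGWs : GW ^ s = 1 := by
    ext w; rw [hGWpow, hG]; rfl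
  have hGWρ : ∀ x, GW * ρW x = ρW (φ x) * GW := by
    intro x
    ext w
    exact LinearMap.congr_fun (hGρ x) w
  have hfW : aeval GW f = 0 := by
    ext w
    rw [hh_aeval_restrict G W GW hGW, hf]; rfl
  have hirr : ∀ S : Submodule K W, (∀ x, ∀ w ∈ S, ρW x w ∈ S) → (∀ w ∈ S, GW w ∈ S) →
      S = ⊥ ∨ S = ⊤ := by
    intro S hS1 hS2
    by_contra! hcon
    apply hWmin (S.map W.subtype)
    · refine ⟨?_, ?_, ?_, ?_⟩
      · intro h
        exact hcon.1 (Submodule.map_injective_of_injective W.injective_subtype (by rw [h, Submodule.map_bot]))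
      · exact (Submodule.map_subtype_le W S).trans hWe
      · rintro x _ ⟨w, hw, rfl⟩
        exact ⟨ρW x w, hS1 x w hw, rfl⟩
      · rintro _ ⟨w, hw, rfl⟩
        exact ⟨GW w, hS2 w hw, rfl⟩
    · refine lt_of_le_of_ne (Submodule.map_subtype_le W S) ?_
      intro h
      apply hcon.2
      rw [eq_top_iff]
      intro w _
      have hw : (w : V) ∈ S.map W.subtype := by rw [h]; exact w.2
      obtain ⟨w', hw', hww⟩ := hw
      have : w' = w := Subtype.ext hww
      rwa [← this]
  have hbij := hh_bij hs φ hφ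
  have hGinv : GW * GW ^ (s - 1) = 1 := by
    rw [← pow_succ', Nat.sub_add_cancel hs.one_le, hGWs]
  have hrad : ∀ x, (∀ y, ρW (y * x) = ρW (x * y)) → x ∈ Subgroup.center Q := by
    let N : Subgroup Q :=
      { carrier := {x | ∀ y, ρW y * ρW x = ρW x * ρW y}
        one_mem' := by intro y; simp
        mul_mem' := by
          intro a b ha hb y
          rw [map_mul, ← mul_assoc, ha y, mul_assoc, hb y, mul_assoc]
        inv_mem' := by
          intro a ha y
          have h1 : ρW a⁻¹ * ρW a = 1 := by rw [← map_mul, inv_mul_cancel, map_one]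
          have h2 : ρW a * ρW a⁻¹ = 1 := by rw [← map_mul, mul_inv_cancel, map_one]
          calc ρW y * ρW a⁻¹ = ρW a⁻¹ * ρW a * ρW y * ρW a⁻¹ := by rw [h1, one_mul]
            _ = ρW a⁻¹ * (ρW y * ρW a) * ρW a⁻¹ := by rw [ha y]; simp only [mul_assoc]
            _ = ρW a⁻¹ * ρW y := by rw [mul_assoc, mul_assoc, h2, mul_one] }
    have hmemN : ∀ x, x ∈ N ↔ ∀ y, ρW y * ρW x = ρW x * ρW y := fun x => Iff.rfl
    have hle : N ≤ Subgroup.center Q := by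
      apply hh_normal_central hs hp hsp hQ φ hφ hmin hne
      · constructor
        intro n hn w
        rw [hmemN] at hn ⊢
        have : ρW (w * n * w⁻¹) = ρW n := by
          rw [map_mul, map_mul, hn, mul_assoc, ← map_mul, mul_inv_cancel, map_one, mul_one]
        rw [this]
        exact hn
      · intro x hx
        rw [hmemN] at hx ⊢
        intro y
        obtain ⟨y, rfl⟩ := hbij.2 y
        have h1 : ρW (φ y) * ρW (φ x) * GW = ρW (φ x) * ρW (φ y) * GW := by
          rw [mul_assoc, ← hGWρ, ← mul_assoc, ← hGWρ, mul_assoc, hx y, ← mul_assoc, hGWρ, mul_assoc,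
            hGWρ, ← mul_assoc]
        calc ρW (φ y) * ρW (φ x) = ρW (φ y) * ρW (φ x) * GW * GW ^ (s - 1) := by
              rw [mul_assoc _ GW, hGinv, mul_one]
          _ = ρW (φ x) * ρW (φ y) := by rw [h1, mul_assoc _ GW, hGinv, mul_one]
      · intro h
        have hx0 : x₀ ∈ N := by rw [h]; trivial
        rw [hmemN] at hx0
        have h1 := hx0 y₀
        rw [← map_mul, hzmul, map_mul, map_mul ρW x₀] at h1
        have h2 : ρW z = 1 := by
          have e : ρW x₀ * ρW y₀ * ρW (y₀⁻¹ * x₀⁻¹) = 1 := by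
            rw [← map_mul, ← map_mul]
            have : x₀ * y₀ * (y₀⁻¹ * x₀⁻¹) = 1 := by group
            rw [this, map_one]
          have h3 : ρW z * (ρW x₀ * ρW y₀) * ρW (y₀⁻¹ * x₀⁻¹) =
              ρW x₀ * ρW y₀ * ρW (y₀⁻¹ * x₀⁻¹) := by rw [h1]
          rwa [mul_assoc, e, mul_one] at h3
        obtain ⟨w, hw⟩ := exists_ne (0 : W)
        have h4 : ρ z (w : V) = c • (w : V) := Module.End.mem_eigenspace_iff.1 (hWe w.2)
        have h5 : ρ z (w : V) = w := by rw [← hρW, h2]; rfl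
        rw [h5] at h4
        have h6 : (c - 1) • (w : V) = 0 := by rw [sub_smul, one_smul, ← h4, sub_self]
        rcases smul_eq_zero.1 h6 with h7 | h7
        · exact hc1 (sub_eq_zero.1 h7)
        · exact hw (Subtype.ext h7)
    intro x hx
    apply hle
    rw [hmemN]
    intro y
    rw [← map_mul, ← map_mul, hx]
  obtain ⟨n, hn, hnle, hndvd⟩ := hh_irred ρW hcard s hs φ hφ GW hGWs hGWρ hZ hcomm hfpf hrad hnc hirr
    f hf0 hfn hfW
  have : Fact p.Prime := ⟨hp⟩
  obtain ⟨m, hm⟩ := IsPGroup.iff_card.1 (hQ.to_quotient (Subgroup.center Q))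
  refine hh_arith hs hp (hn.trans hm) ?_ hnle hndvd
  rw [hn]
  exact (Subgroup.one_lt_index_of_ne_top hnc)

theorem hh_subab {K V T : Type*} [Field K] [IsAlgClosed K] [AddCommGroup V] [Module K V]
    [FiniteDimensional K V] [Group T] [Finite T] {s p : ℕ} (hs : s.Prime)
    (hp : p.Prime) (hT : IsPGroup p T) (hpK : (p : K) ≠ 0)
    (ρ : T →* Module.End K V) (hρ : Function.Injective ρ)
    (φ : Monoid.End T) (hφ : φ ^ s = 1) (G : Module.End K V) (hG : G ^ s = 1)
    (hGρ : ∀ x, G * ρ x = ρ (φ x) * G)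
    (f : K[X]) (hf0 : f ≠ 0) (hfn : f.natDegree < s) (hf : aeval G f = 0)
    (A : Subgroup T) (hA : ∀ x ∈ A, φ x ∈ A) (hAc : ∀ x ∈ A, ∀ y ∈ A, x * y = y * x) :
    ∀ x ∈ A, φ x = x := by
  obtain ⟨ψ, hψ, hψs⟩ := hh_restrict φ s hφ A hA
  intro x hx
  apply hρ
  have := hh_abelian (fun x y => Subtype.ext (hAc x x.2 y y.2))
    (hh_card_ne (K := K) hp (hT.to_subgroup A) hpK) (ρ.comp A.subtype) s hs ψ hψs G hG
    (by intro x; simp only [MonoidHom.comp_apply, Subgroup.subtype_apply]; rw [hψ, hGρ]) f hf0 hfn hf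
    ⟨x, hx⟩
  simp only [MonoidHom.comp_apply, Subgroup.subtype_apply] at this
  rwa [hψ] at this

theorem hh_main {K V T : Type*} [Field K] [IsAlgClosed K] [AddCommGroup V] [Module K V]
    [FiniteDimensional K V] [Group T] [Finite T] {s p : ℕ} (hs : s.Prime)
    (hp : p.Prime) (hsp : s ≠ p) (hT : IsPGroup p T) (hpK : (p : K) ≠ 0)
    (ρ : T →* Module.End K V) (hρ : Function.Injective ρ)
    (φ : Monoid.End T) (hφ : φ ^ s = 1) (G : Module.End K V) (hG : G ^ s = 1)
    (hGρ : ∀ x, G * ρ x = ρ (φ x) * G)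
    (f : K[X]) (hf0 : f ≠ 0) (hfn : f.natDegree < s) (hf : aeval G f = 0)
    (hne : ∃ x, φ x ≠ x) :
    (∃ x, x ≠ 1 ∧ φ x = x) ∧ (¬ ∀ x y : T, x * y = y * x) ∧
    (p = 2 ∧ ∃ δ : ℕ, s = 2 ^ (2 ^ δ) + 1) := by
  have hab := hh_subab hs hp hT hpK ρ hρ φ hφ G hG hGρ f hf0 hfn hf
  have hbij := hh_bij hs φ hφ
  refine ⟨?_, ?_, ?_⟩
  · have : Fact p.Prime := ⟨hp⟩
    have : Nontrivial T := by
      obtain ⟨x, hx⟩ := hne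
      exact ⟨_, _, hx⟩
    have hc : Nontrivial (Subgroup.center T) := hT.center_nontrivial
    obtain ⟨z, hz⟩ := exists_ne (1 : Subgroup.center T)
    refine ⟨z, fun h => hz (Subtype.ext h), ?_⟩
    refine hab (Subgroup.center T) ?_ ?_ z z.2
    · intro x hx
      rw [Subgroup.mem_center_iff] at hx ⊢
      intro y
      obtain ⟨y, rfl⟩ := hbij.2 y
      rw [← map_mul, hx, map_mul]
    · intro x _ y hy
      exact Subgroup.mem_center_iff.1 hy x
  · intro h
    obtain ⟨x, hx⟩ := hne
    exact hx (hab ⊤ (fun _ _ => trivial) (fun x _ y _ => h x y) x trivial)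
  · obtain ⟨Q, hQφ, ⟨x, hxQ, hx⟩, hQmin⟩ := hh_minimal φ hne
    obtain ⟨ψ, hψ, hψs⟩ := hh_restrict φ s hφ Q hQφ
    refine hh_minQ (Q := Q) hs hp hsp (hT.to_subgroup Q) hpK (ρ.comp Q.subtype)
      (hρ.comp Q.subtype_injective) ψ hψs G hG
      (by intro x; simp only [MonoidHom.comp_apply, Subgroup.subtype_apply]; rw [hψ, hGρ]) f hf0 hfn hf
      ?_ ⟨⟨x, hxQ⟩, fun h => hx (by rw [← hψ ⟨x, hxQ⟩, h])⟩
    intro N hNφ hN x hxN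
    apply Subtype.ext
    rw [hψ]
    refine hQmin (N.map Q.subtype) ?_ ?_ x ⟨x, hxN, rfl⟩
    · refine lt_of_le_of_ne (Subgroup.map_subtype_le N) ?_
      intro h
      apply hN
      rw [Subgroup.eq_top_iff']
      intro y
      have hy : (y : T) ∈ N.map Q.subtype := by rw [h]; exact y.2
      obtain ⟨y', hy', hyy⟩ := hy
      have : y' = y := Subtype.ext hyy
      rwa [← this]
    · rintro _ ⟨y, hy, rfl⟩
      exact ⟨ψ y, hNφ y hy, hψ y⟩

/-- Let `s ≠ p` be primes and let `H = T ⋊ ⟨g⟩` be a finite group, where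
`T` is a normal `p`-subgroup, `g` has order `s`, and `[T, g] ≠ 1`.  Suppose `H` acts
faithfully and linearly on a finite-dimensional vector space `V` over a field of prime
characteristic `t ≠ p`.  If the minimal polynomial of the action of `g` on `V` is not
`X^s - 1`, then (i) `C_T(g) ≠ 1`, (ii) `T` is nonabelian, and (iii) `p = 2` and
`s = 2^(2^δ) + 1` is a Fermat prime. -/
theorem consequences_of_small_minpoly (s p : ℕ) (hs : s.Prime) (hp : p.Prime) (hsp : s ≠ p)
    (H : Type*) [Group H] [Fintype H] (T : Subgroup H) (hTnormal : T.Normal)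
    (hTp : IsPGroup p T) (g : H) (hg : orderOf g = s)
    (hprod : T ⊔ Subgroup.zpowers g = ⊤) (hint : T ⊓ Subgroup.zpowers g = ⊥)
    (hcomm : ∃ x ∈ T, g * x * g⁻¹ ≠ x)
    (k : Type*) [Field k] (t : ℕ) (ht : t.Prime) [CharP k t] (htp : t ≠ p)
    (V : Type*) [AddCommGroup V] [Module k V] [FiniteDimensional k V]
    (ρ : H →* (V →ₗ[k] V)) (hfaithful : Function.Injective ρ)
    (hmin : minpoly k (ρ g) ≠ X ^ s - 1) :
    (∃ x ∈ T, x ≠ 1 ∧ g * x * g⁻¹ = x) ∧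
    (¬ ∀ x ∈ T, ∀ y ∈ T, x * y = y * x) ∧
    (p = 2 ∧ ∃ δ : ℕ, s = 2 ^ (2 ^ δ) + 1) := by
  have hcardp : (p : k) ≠ 0 := by
    intro h
    rw [CharP.cast_eq_zero_iff k t p] at h
    exact htp ((Nat.prime_dvd_prime_iff_eq ht hp).1 h)
  have hgs : g ^ s = 1 := by rw [← hg]; exact pow_orderOf_eq_one g
  let K := AlgebraicClosure k
  let bc := Module.End.baseChangeHom k K V
  have hbc : Function.Injective bc := LinearMap.baseChangeHom_injective k V K
  let ρ₀ : H →* Module.End k V := ρ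
  let ρK : H →* Module.End K (TensorProduct k K V) := (bc : _ →* _).comp ρ₀
  have hρK : ∀ h, ρK h = bc (ρ h) := fun h => rfl
  let φ : Monoid.End T := ((MulAut.conjNormal g : MulAut T) : T →* T)
  have hφ1 : ∀ x : T, ((φ x : T) : H) = g * x * g⁻¹ := fun x => MulAut.conjNormal_apply g x
  have hφi : ∀ (i : ℕ) (x : T), (((φ ^ i) x : T) : H) = g ^ i * x * (g ^ i)⁻¹ := by
    intro i
    induction i with
    | zero => intro x; simp
    | succ i ih =>
      intro x
      have : (φ ^ (i + 1)) x = φ ((φ ^ i) x) := by rw [pow_succ']; rfl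
      rw [this, hφ1, ih, pow_succ']
      group
  have hφ : φ ^ s = 1 := by
    refine MonoidHom.ext fun x => Subtype.ext ((hφi s x).trans ?_)
    rw [hgs, one_mul, inv_one, mul_one]; rfl
  have hminm : (minpoly k (ρ g)).Monic := minpoly.monic (Algebra.IsIntegral.isIntegral _)
  have hdeg : (minpoly k (ρ g)).natDegree < s := by
    have hd : minpoly k (ρ g) ∣ X ^ s - 1 := by
      apply minpoly.dvd
      rw [map_sub, map_pow, aeval_X, map_one, ← map_pow, hgs, map_one, sub_self]
    have hm : (X ^ s - 1 : k[X]).Monic := monic_X_pow_sub_C 1 hs.ne_zero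
    have hn : (X ^ s - 1 : k[X]).natDegree = s := natDegree_X_pow_sub_C (r := (1 : k))
    have hle := natDegree_le_of_dvd hd hm.ne_zero
    rw [hn] at hle
    refine lt_of_le_of_ne hle fun h => hmin ?_
    exact (eq_of_monic_of_dvd_of_natDegree_le hminm hm hd (by rw [hn, h])).symm
  obtain ⟨h1, h2, h3⟩ := hh_main (K := K) (V := TensorProduct k K V) (T := T) hs hp hsp hTp
    (by
      intro h
      apply hcardp
      apply (algebraMap k K).injective
      rw [map_natCast, h, map_zero])
    (ρK.comp T.subtype) (hbc.comp (hfaithful.comp T.subtype_injective)) φ hφ (ρK g)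
    (by rw [← map_pow, hgs, map_one])
    (by
      intro x
      simp only [MonoidHom.comp_apply, Subgroup.subtype_apply]
      rw [← map_mul, ← map_mul, hφ1]
      congr 1
      group)
    ((minpoly k (ρ g)).map (algebraMap k K))
    ((Polynomial.map_ne_zero_iff (algebraMap k K).injective).2 hminm.ne_zero)
    (by rwa [natDegree_map])
    (by
      rw [aeval_map_algebraMap, hρK, aeval_algHom_apply, minpoly.aeval, map_zero])
    (by
      obtain ⟨x, hx, hxg⟩ := hcomm
      exact ⟨⟨x, hx⟩, fun h => hxg (by rw [← hφ1 ⟨x, hx⟩, h])⟩)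
  refine ⟨?_, ?_, h3⟩
  · obtain ⟨x, hx1, hx⟩ := h1
    exact ⟨x, x.2, fun h => hx1 (Subtype.ext h), by rw [← hφ1, hx]⟩
  · intro h
    exact h2 fun x y => Subtype.ext (h x x.2 y y.2)
end

section
/- Let F be a finite field of order q and characteristic p, let n ≥ 2, and let L = L_n(q) = SL_n(F)/Z(SL_n(F)). Suppose r and s are distinct primes not dividing q(q^2 − 1), with i the multiplicative order of q modulo r and j the multiplicative order of q modulo s. Then: (i) if L contains an element of order rs, then for every pair of distinct odd primes r', s' with multiplicative order of q modulo r' equal to i and multiplicative order of q modulo s' equal to j, L contains an element of order r's'; (ii) if L contains an element of order pr, then for every odd prime r' with multiplicative order of q modulo r' equal to i, L contains an element of order pr'. -/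
open Matrix

namespace VasilevAux

variable {F : Type*} [Field F] [Fintype F]

/-- Central elements of `SL_n` are killed by `q - 1`. -/
lemma center_pow {n : ℕ} (hn : 2 ≤ n) (z : SpecialLinearGroup (Fin n) F)
    (hz : z ∈ Subgroup.center (SpecialLinearGroup (Fin n) F)) :
    z ^ (Fintype.card F - 1) = 1 := by
  obtain ⟨c, hc, hcz⟩ := Matrix.SpecialLinearGroup.mem_center_iff.mp hz
  have hc0 : c ≠ 0 := by
    rintro rfl
    rw [Fintype.card_fin, zero_pow (by omega)] at hc
    exact zero_ne_one hc
  apply Subtype.ext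
  rw [Matrix.SpecialLinearGroup.coe_pow, ← hcz, ← map_pow, FiniteField.pow_card_sub_one_eq_one c hc0]
  simp

lemma psl_to_matrix {n m : ℕ} (hn : 2 ≤ n) (hm : m.Coprime (Fintype.card F - 1))
    (x : ProjectiveSpecialLinearGroup (Fin n) F) (hx : orderOf x = m) :
    ∃ A : Matrix (Fin n) (Fin n) F, orderOf A = m := by
  obtain ⟨g, rfl⟩ := QuotientGroup.mk_surjective x
  have h1 : g ^ m ∈ Subgroup.center (SpecialLinearGroup (Fin n) F) := by
    rw [← QuotientGroup.eq_one_iff, QuotientGroup.mk_pow, ← hx]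
    exact pow_orderOf_eq_one _
  have h2 := center_pow hn _ h1
  have h3 : orderOf (g ^ (Fintype.card F - 1)) = m := by
    apply Nat.dvd_antisymm
    · apply orderOf_dvd_of_pow_eq_one
      rw [← pow_mul, mul_comm, pow_mul, h2]
    · have h4 : orderOf ((g : ProjectiveSpecialLinearGroup (Fin n) F) ^ (Fintype.card F - 1)) = m := by
        rw [Nat.Coprime.orderOf_pow, hx]
        rwa [hx]
      rw [← h4]
      exact orderOf_map_dvd (QuotientGroup.mk' (Subgroup.center (SpecialLinearGroup (Fin n) F))) _
  refine ⟨((g ^ (Fintype.card F - 1) : SpecialLinearGroup (Fin n) F) : Matrix _ _ F), ?_⟩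
  rw [← h3]
  exact orderOf_injective (
    ({ toFun := fun A => (A : Matrix (Fin n) (Fin n) F), map_one' := rfl, map_mul' := fun _ _ => rfl } :
      SpecialLinearGroup (Fin n) F →* Matrix (Fin n) (Fin n) F)) Subtype.val_injective (g ^ (Fintype.card F - 1))

lemma matrix_to_psl {n m : ℕ} (hn : 2 ≤ n) (hm0 : 0 < m) (hm : m.Coprime (Fintype.card F - 1))
    (A : Matrix (Fin n) (Fin n) F) (hA : orderOf A = m) :
    ∃ x : ProjectiveSpecialLinearGroup (Fin n) F, orderOf x = m := by
  have hdm : A.det ^ m = 1 := by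
    rw [← det_pow, ← hA, pow_orderOf_eq_one, det_one]
  have hd0 : A.det ≠ 0 := by
    intro h
    rw [h, zero_pow hm0.ne'] at hdm
    exact zero_ne_one hdm
  have hd : A.det = 1 := by
    have h1 := orderOf_dvd_of_pow_eq_one hdm
    have h2 := orderOf_dvd_of_pow_eq_one (FiniteField.pow_card_sub_one_eq_one _ hd0)
    have h3 := Nat.dvd_gcd h1 h2
    rw [hm.gcd_eq_one] at h3
    exact orderOf_eq_one_iff.mp (Nat.dvd_one.mp h3)
  let g : SpecialLinearGroup (Fin n) F := ⟨A, hd⟩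
  have hg : orderOf g = m := by
    rw [← hA]
    exact (orderOf_injective (
      ({ toFun := fun A => (A : Matrix (Fin n) (Fin n) F), map_one' := rfl, map_mul' := fun _ _ => rfl } :
      SpecialLinearGroup (Fin n) F →* Matrix (Fin n) (Fin n) F)) Subtype.val_injective g).symm
  refine ⟨(QuotientGroup.mk g), ?_⟩
  apply Nat.dvd_antisymm
  · rw [← hg]
    exact orderOf_map_dvd (QuotientGroup.mk' (Subgroup.center (SpecialLinearGroup (Fin n) F))) _
  · set k := orderOf (QuotientGroup.mk g : ProjectiveSpecialLinearGroup (Fin n) F) with hk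
    have h1 : g ^ k ∈ Subgroup.center (SpecialLinearGroup (Fin n) F) := by
      rw [← QuotientGroup.eq_one_iff, QuotientGroup.mk_pow, hk]
      exact pow_orderOf_eq_one _
    have h2 := center_pow hn _ h1
    rw [← pow_mul] at h2
    have h3 := orderOf_dvd_of_pow_eq_one h2
    rw [hg] at h3
    exact hm.dvd_of_dvd_mul_right h3

/-- There is a linear endomorphism of `F^n` of order `m`. -/
def HasOrd (F : Type*) [Field F] (n m : ℕ) : Prop :=
  ∃ f : Module.End F (Fin n → F), orderOf f = m

lemma psl_iff {n m : ℕ} (hn : 2 ≤ n) (hm0 : 0 < m) (hm : m.Coprime (Fintype.card F - 1)) :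
    (∃ x : ProjectiveSpecialLinearGroup (Fin n) F, orderOf x = m) ↔ HasOrd F n m := by
  constructor
  · rintro ⟨x, hx⟩
    obtain ⟨A, hA⟩ := psl_to_matrix hn hm x hx
    refine ⟨Matrix.toLinAlgEquiv' A, ?_⟩
    rw [← hA]
    exact MulEquiv.orderOf_eq (Matrix.toLinAlgEquiv' (R := F) (n := Fin n)).toMulEquiv A
  · rintro ⟨f, hf⟩
    refine matrix_to_psl hn hm0 hm (LinearMap.toMatrixAlgEquiv' f) ?_
    rw [← hf]
    exact MulEquiv.orderOf_eq (LinearMap.toMatrixAlgEquiv' (R := F) (n := Fin n)).toMulEquiv f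

lemma HasOrd.of_end {V : Type*} [AddCommGroup V] [Module F V] [Module.Finite F V] {n : ℕ}
    (hV : Module.finrank F V = n) (f : Module.End F V) : HasOrd F n (orderOf f) := by
  have e : V ≃ₗ[F] (Fin n → F) := LinearEquiv.ofFinrankEq _ _ (by simp [hV])
  exact ⟨e.conjRingEquiv f, MulEquiv.orderOf_eq e.conjRingEquiv.toMulEquiv f⟩

lemma HasOrd.add {k l a b : ℕ} (h1 : HasOrd F k a) (h2 : HasOrd F l b) :
    HasOrd F (k + l) (a.lcm b) := by
  obtain ⟨f, rfl⟩ := h1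
  obtain ⟨g, rfl⟩ := h2
  rw [show (orderOf f).lcm (orderOf g) = orderOf (f, g) from (Prod.orderOf (f, g)).symm,
    ← orderOf_injective (LinearMap.prodMapRingHom F (Fin k → F) (Fin l → F)).toMonoidHom]
  · apply HasOrd.of_end
    simp
  · rintro ⟨a, b⟩ ⟨c, d⟩ h
    have h' : a.prodMap b = c.prodMap d := h
    ext x i
    · have := congrArg (fun T => (T (Pi.single x 1, 0)).1 i) h'
      simpa using this
    · have := congrArg (fun T => (T (0, Pi.single x 1)).2 i) h'
      simpa using this

lemma HasOrd.mono {k n a : ℕ} (hkn : k ≤ n) (h1 : HasOrd F k a) : HasOrd F n a := by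
  have h := h1.add (l := n - k) (b := 1) ⟨1, orderOf_one⟩
  rwa [Nat.lcm_one_right, Nat.add_sub_cancel' hkn] at h

/-- Singer-type elements. -/
lemma HasOrd.singer (p : ℕ) (hp : p.Prime) [CharP F p] {k N : ℕ} (hk : 0 < k)
    (hN : N ∣ Fintype.card F ^ k - 1) : HasOrd F k N := by
  haveI : Fact p.Prime := ⟨hp⟩
  haveI : NeZero k := ⟨hk.ne'⟩
  let E := FiniteField.Extension F p k
  obtain ⟨g, hg⟩ := IsCyclic.exists_ofOrder_eq_natCard (α := Eˣ)
  have hc : Nat.card Eˣ = Fintype.card F ^ k - 1 := by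
    rw [Nat.card_units, FiniteField.natCard_extension, Nat.card_eq_fintype_card]
  have hpos : 0 < Fintype.card F ^ k - 1 := by
    rw [← hc]; exact Nat.card_pos
  obtain ⟨d, hd⟩ := hN
  have ho : orderOf (g ^ d) = N := by
    have hd0 : 0 < d := by
      rcases Nat.eq_zero_or_pos d with h | h
      · rw [h] at hd; omega
      · exact h
    rw [orderOf_pow, hg, hc, hd, Nat.gcd_eq_right (Dvd.intro_left N rfl), Nat.mul_div_cancel _ hd0]
  rw [← ho, ← orderOf_units, ← orderOf_injective (Algebra.lmul F E).toMonoidHom]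
  · exact HasOrd.of_end (FiniteField.finrank_extension F p k) _
  · exact Algebra.lmul_injective

lemma HasOrd.unip (p : ℕ) (hp : p.Prime) [CharP F p] : HasOrd F 2 p := by
  have hpow : ∀ k : ℕ, (!![1, 1; 0, 1] : Matrix (Fin 2) (Fin 2) F) ^ k = !![1, (k : F); 0, 1] := by
    intro k
    induction k with
    | zero => ext i j; fin_cases i <;> fin_cases j <;> simp
    | succ k ih => rw [pow_succ, ih]; simp [add_comm]
  have : orderOf (!![1, 1; 0, 1] : Matrix (Fin 2) (Fin 2) F) = p := by
    haveI : Fact p.Prime := ⟨hp⟩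
    apply orderOf_eq_prime
    · rw [hpow, CharP.cast_eq_zero]; ext i j; fin_cases i <;> fin_cases j <;> simp
    · intro h
      have := congrFun (congrFun h 0) 1
      simp at this
  refine ⟨Matrix.toLinAlgEquiv' (!![1, 1; 0, 1] : Matrix (Fin 2) (Fin 2) F), ?_⟩
  conv_rhs => rw [← this]
  exact MulEquiv.orderOf_eq (Matrix.toLinAlgEquiv' (R := F) (n := Fin 2)).toMulEquiv _

section count

variable {V : Type*} [AddCommGroup V] [Module F V] [Module.Finite F V]

/-- Fixed subspace. -/
def fix (t : Module.End F V) : Submodule F V := LinearMap.ker (t - 1)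

lemma mem_fix {t : Module.End F V} {v : V} : v ∈ fix t ↔ t v = v := by
  simp [fix, sub_eq_zero]

lemma count_modEq {r : ℕ} (hr : r.Prime) (t : Module.End F V) (ht : t ^ r = 1)
    (W : Submodule F V) (hW : ∀ w ∈ W, t w ∈ W) :
    Fintype.card F ^ Module.finrank F W ≡
      Fintype.card F ^ Module.finrank F (W ⊓ fix t : Submodule F V) [MOD r] := by
  classical
  haveI : Fact r.Prime := ⟨hr⟩
  haveI : Finite V := Module.finite_of_finite F
  haveI : Fintype V := Fintype.ofFinite V
  let f : Function.End W := fun w => ⟨t w, hW w w.2⟩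
  have hfk : ∀ (k : ℕ) (w : W), ((f ^ k) w : V) = (t ^ k) w := by
    intro k
    induction k with
    | zero => intro w; rfl
    | succ k ih =>
      intro w
      rw [pow_succ, pow_succ]
      exact ih (f w)
  have hf : f ^ r ^ 1 = 1 := by
    funext w
    apply Subtype.ext
    rw [hfk, pow_one, ht]
    rfl
  have h := Equiv.Perm.card_fixedPoints_modEq hf
  rw [← Nat.card_eq_fintype_card, ← Nat.card_eq_fintype_card,
    Module.natCard_eq_pow_finrank (K := F) (V := W)] at h
  have e : Function.fixedPoints f ≃ (W ⊓ fix t : Submodule F V) :=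
    { toFun := fun w => ⟨w.1.1, w.1.2, mem_fix.mpr (congrArg Subtype.val w.2)⟩
      invFun := fun w => ⟨⟨w.1, w.2.1⟩, Subtype.ext (mem_fix.mp w.2.2)⟩
      left_inv := fun w => rfl
      right_inv := fun w => rfl }
  rw [Nat.card_congr e, Module.natCard_eq_pow_finrank (K := F)
    (V := (W ⊓ fix t : Submodule F V)), Nat.card_eq_fintype_card] at h
  exact h

lemma count_dvd {r i : ℕ} (hr : r.Prime) (hrq : ¬ r ∣ Fintype.card F)
    (hi : orderOf (Fintype.card F : ZMod r) = i) (t : Module.End F V) (ht : t ^ r = 1)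
    (W : Submodule F V) (hW : ∀ w ∈ W, t w ∈ W) :
    ∃ k, Module.finrank F W = Module.finrank F (W ⊓ fix t : Submodule F V) + i * k := by
  haveI : Fact r.Prime := ⟨hr⟩
  have h := count_modEq hr t ht W hW
  have hle : Module.finrank F (W ⊓ fix t : Submodule F V) ≤ Module.finrank F W :=
    Submodule.finrank_mono inf_le_left
  obtain ⟨e, he⟩ := Nat.exists_eq_add_of_le hle
  rw [he, ← ZMod.natCast_eq_natCast_iff] at h
  push_cast at h
  rw [pow_add] at h
  have hq0 : (Fintype.card F : ZMod r) ≠ 0 := by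
    rwa [Ne, ZMod.natCast_eq_zero_iff]
  have h1 : (Fintype.card F : ZMod r) ^ e = 1 :=
    mul_left_cancel₀ (pow_ne_zero _ hq0) (h.trans (mul_one _).symm)
  obtain ⟨k, hk⟩ := orderOf_dvd_of_pow_eq_one h1
  exact ⟨k, by rw [he, hk, hi]⟩

lemma count_p {p : ℕ} (hp : p.Prime) [CharP F p] (u : Module.End F V) (hu : u ^ p = 1)
    (W : Submodule F V) (hW : ∀ w ∈ W, u w ∈ W) (h0 : 0 < Module.finrank F W) :
    0 < Module.finrank F (W ⊓ fix u : Submodule F V) := by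
  by_contra hc
  have h := count_modEq hp u hu W hW
  rw [Nat.eq_zero_of_not_pos hc, pow_zero] at h
  have hpq : p ∣ Fintype.card F := (CharP.cast_eq_zero_iff F p _).mp (FiniteField.cast_card_eq_zero F)
  have h2 : p ∣ Fintype.card F ^ Module.finrank F W := dvd_pow hpq h0.ne'
  have h3 := (Nat.modEq_zero_iff_dvd.mpr h2).symm.trans h
  have h4 := Nat.modEq_zero_iff_dvd.mp h3.symm
  exact hp.one_lt.ne' (Nat.dvd_one.mp h4)

lemma fix_inv {t u : Module.End F V} (h : Commute t u) : ∀ w ∈ fix t, u w ∈ fix t := by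
  intro w hw
  rw [mem_fix] at *
  rw [← Module.End.mul_apply, h.eq, Module.End.mul_apply, hw]

lemma fix_eq_top {t : Module.End F V} (h : fix t = ⊤) : t = 1 := by
  ext v
  exact mem_fix.mp (h ▸ Submodule.mem_top)

lemma finrank_fix_lt {t : Module.End F V} (h : t ≠ 1) :
    Module.finrank F (fix t) < Module.finrank F V :=
  Submodule.finrank_lt fun h' => h (fix_eq_top h')

lemma rs_bound {r s i j : ℕ} (hr : r.Prime) (hs : s.Prime)
    (hrq : ¬ r ∣ Fintype.card F) (hsq : ¬ s ∣ Fintype.card F)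
    (hi : orderOf (Fintype.card F : ZMod r) = i) (hj : orderOf (Fintype.card F : ZMod s) = j)
    (t u : Module.End F V) (htu : Commute t u) (ht : t ^ r = 1) (hu : u ^ s = 1)
    (ht1 : t ≠ 1) (hu1 : u ≠ 1) :
    i + j ≤ Module.finrank F V ∨ i.lcm j ≤ Module.finrank F V := by
  obtain ⟨a, ha⟩ := count_dvd hr hrq hi t ht ⊤ (fun _ _ => trivial)
  obtain ⟨b, hb⟩ := count_dvd hs hsq hj u hu ⊤ (fun _ _ => trivial)
  obtain ⟨c, hc⟩ := count_dvd hs hsq hj u hu (fix t) (fix_inv htu)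
  obtain ⟨d, hd⟩ := count_dvd hr hrq hi t ht (fix u) (fix_inv htu.symm)
  have h1 := finrank_fix_lt ht1
  have h2 := finrank_fix_lt hu1
  rw [top_inf_eq, finrank_top] at ha hb
  rw [inf_comm] at hd
  have key : ∀ x y : ℕ, 0 < y → x ≤ x * y := fun x y h => Nat.le_mul_of_pos_right x h
  have ha0 : 0 < a := by
    rcases Nat.eq_zero_or_pos a with h | h
    · subst h; omega
    · exact h
  have hb0 : 0 < b := by
    rcases Nat.eq_zero_or_pos b with h | h
    · subst h; omega
    · exact h
  have ka := key i a ha0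
  have kb := key j b hb0
  rcases Nat.eq_zero_or_pos c with h | h
  · rcases Nat.eq_zero_or_pos d with h' | h'
    · right
      subst h; subst h'
      have e : i * a = j * b := by omega
      have h3 : i.lcm j ∣ i * a := Nat.lcm_dvd (Dvd.intro _ rfl) (e ▸ Dvd.intro _ rfl)
      have h4 := Nat.le_of_dvd (by omega) h3
      omega
    · left
      have := key i d h'
      omega
  · left
    have := key j c h
    omega

lemma pr_bound {r p i : ℕ} (hr : r.Prime) (hp : p.Prime) [CharP F p]
    (hrq : ¬ r ∣ Fintype.card F)
    (hi : orderOf (Fintype.card F : ZMod r) = i) (hi2 : 2 ≤ i)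
    (t u : Module.End F V) (htu : Commute t u) (ht : t ^ r = 1) (hu : u ^ p = 1)
    (ht1 : t ≠ 1) (hu1 : u ≠ 1) :
    i + 2 ≤ Module.finrank F V := by
  obtain ⟨a, ha⟩ := count_dvd hr hrq hi t ht ⊤ (fun _ _ => trivial)
  have h1 := finrank_fix_lt ht1
  rw [top_inf_eq, finrank_top] at ha
  have key : ∀ x y : ℕ, 0 < y → x ≤ x * y := fun x y h => Nat.le_mul_of_pos_right x h
  have ha0 : 0 < a := by
    rcases Nat.eq_zero_or_pos a with h | h
    · subst h; omega
    · exact h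
  have ka := key i a ha0
  by_cases hle : fix t ≤ fix u
  · -- `u` is trivial on the fixed space of `t`
    set W : Submodule F V := LinearMap.range (t - 1) with hWdef
    have htW : ∀ w ∈ W, t w ∈ W := by
      rintro _ ⟨v, rfl⟩
      exact ⟨t v, by simp⟩
    have huW : ∀ w ∈ W, u w ∈ W := by
      rintro _ ⟨v, rfl⟩
      refine ⟨u v, ?_⟩
      have := LinearMap.congr_fun htu.eq v
      simp only [Module.End.mul_apply] at this
      simp [this]
    have hdisj : W ⊓ fix t = ⊥ := by
      rw [eq_bot_iff]
      rintro w ⟨⟨v, hv⟩, hw⟩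
      have hw' : t w = w := mem_fix.mp hw
      have hv' : t v = v + w := by
        rw [← hv]; simp
      have hk : ∀ k : ℕ, (t ^ k) v = v + (k : F) • w := by
        intro k
        induction k with
        | zero => simp
        | succ k ih =>
          rw [pow_succ', Module.End.mul_apply, ih, map_add, map_smul, hw', hv']
          push_cast
          rw [add_smul, one_smul]
          abel
      have h := hk r
      rw [ht, Module.End.one_apply] at h
      have h' : (r : F) • w = 0 := by simpa using h
      rcases smul_eq_zero.mp h' with h'' | h''
      · exfalso
        have hpr : p ∣ r := (CharP.cast_eq_zero_iff F p r).mp h''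
        have : p = r := (Nat.prime_dvd_prime_iff_eq hp hr).mp hpr
        subst this
        exact hrq ((CharP.cast_eq_zero_iff F p _).mp (FiniteField.cast_card_eq_zero F))
      · simpa using h''
    have hdim : Module.finrank F W + Module.finrank F (fix t) = Module.finrank F V :=
      LinearMap.finrank_range_add_finrank_ker (t - 1)
    have hW0 : 0 < Module.finrank F W := by omega
    have hU0 := count_p hp u hu W huW hW0
    have hUlt : Module.finrank F (W ⊓ fix u : Submodule F V) < Module.finrank F W := by
      refine Submodule.finrank_lt_finrank_of_lt (lt_of_le_of_ne inf_le_left fun he => hu1 ?_)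
      apply fix_eq_top
      have hsup : W ⊔ fix t = ⊤ := by
        apply Submodule.eq_top_of_finrank_eq
        have := Submodule.finrank_sup_add_finrank_inf_eq W (fix t)
        rw [hdisj, finrank_bot] at this
        omega
      rw [eq_top_iff, ← hsup]
      exact sup_le (inf_eq_left.mp he) hle
    obtain ⟨b, hb⟩ := count_dvd hr hrq hi t ht W htW
    obtain ⟨c, hc⟩ := count_dvd hr hrq hi t ht (W ⊓ fix u)
      (fun w hw => ⟨htW w hw.1, fix_inv htu.symm w hw.2⟩)
    have hd2 : W ⊓ fix u ⊓ fix t = ⊥ := by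
      rw [inf_right_comm, hdisj, bot_inf_eq]
    rw [hdisj, finrank_bot] at hb
    rw [hd2, finrank_bot] at hc
    have hc0 : 0 < c := by
      rcases Nat.eq_zero_or_pos c with h | h
      · subst h; omega
      · exact h
    have hcb : c < b := by
      by_contra hcb
      have := Nat.mul_le_mul_left i (not_lt.mp hcb)
      omega
    have := Nat.mul_le_mul_left i (show 2 ≤ b by omega)
    omega
  · have hlt : Module.finrank F (fix t ⊓ fix u : Submodule F V) < Module.finrank F (fix t) :=
      Submodule.finrank_lt_finrank_of_lt
        (lt_of_le_of_ne inf_le_left fun he => hle (inf_eq_left.mp he))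
    have := count_p hp u hu (fix t) (fix_inv htu) (by omega)
    omega

end count

/-- Splitting an element of order `ab`. -/
lemma split {M : Type*} [Monoid M] {a b : ℕ} (ha : 1 < a) (hb : 1 < b) (g : M)
    (hg : orderOf g = a * b) : ∃ t u : M, Commute t u ∧ t ^ a = 1 ∧ u ^ b = 1 ∧ t ≠ 1 ∧ u ≠ 1 := by
  refine ⟨g ^ b, g ^ a, (Commute.refl g).pow_pow _ _, ?_, ?_, ?_, ?_⟩
  · rw [← pow_mul, mul_comm, ← hg, pow_orderOf_eq_one]
  · rw [← pow_mul, ← hg, pow_orderOf_eq_one]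
  · intro h
    have := Nat.le_of_dvd (by omega) (orderOf_dvd_of_pow_eq_one h)
    rw [hg] at this
    nlinarith
  · intro h
    have := Nat.le_of_dvd (by omega) (orderOf_dvd_of_pow_eq_one h)
    rw [hg] at this
    nlinarith

lemma order_ge_three {r q : ℕ} (hr : r.Prime) (hq : 2 ≤ q) (h : ¬ r ∣ q * (q ^ 2 - 1)) :
    3 ≤ orderOf (q : ZMod r) := by
  haveI : Fact r.Prime := ⟨hr⟩
  have h0 : (q : ZMod r) ≠ 0 := by
    rw [Ne, ZMod.natCast_eq_zero_iff]
    exact fun h' => h (h'.mul_right _)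
  have hpos : 0 < orderOf (q : ZMod r) := by
    rw [orderOf_pos_iff, isOfFinOrder_iff_pow_eq_one]
    exact ⟨r - 1, by have := hr.two_le; omega, ZMod.pow_card_sub_one_eq_one h0⟩
  have h2 : (q : ZMod r) ^ 2 ≠ 1 := by
    intro h'
    apply h
    apply Dvd.dvd.mul_left
    rw [← ZMod.natCast_eq_zero_iff, Nat.cast_sub (Nat.one_le_pow _ _ (by omega))]
    push_cast
    rw [h', sub_self]
  by_contra hlt
  apply h2
  rw [← orderOf_dvd_iff_pow_eq_one]
  have : orderOf (q : ZMod r) = 1 ∨ orderOf (q : ZMod r) = 2 := by omega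
  rcases this with h | h <;> rw [h] <;> norm_num

lemma dvd_of_order {r q k : ℕ} (hq : 2 ≤ q) (h : orderOf (q : ZMod r) ∣ k) :
    r ∣ q ^ k - 1 := by
  rw [← ZMod.natCast_eq_zero_iff, Nat.cast_sub (Nat.one_le_pow _ _ (by omega))]
  push_cast
  rw [orderOf_dvd_iff_pow_eq_one.mp h, sub_self]

lemma coprime_of_order {r q : ℕ} (hr : r.Prime) (hq : 2 ≤ q) (h : 3 ≤ orderOf (q : ZMod r)) :
    r.Coprime (q - 1) := by
  rw [hr.coprime_iff_not_dvd]
  intro h'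
  rw [← ZMod.natCast_eq_zero_iff, Nat.cast_sub (by omega), sub_eq_zero, Nat.cast_one] at h'
  rw [h', orderOf_one] at h
  omega

end VasilevAux


/-- **Vasil'ev's lemma for linear groups.** Let `F` be a finite field of order
`q` and characteristic `p`, let `n ≥ 2`, and `L = L_n(q) = SL_n(F)/Z(SL_n(F))`.  Let `r, s`
be distinct primes not dividing `q(q² - 1)`, with `i = e(r,q)` and `j = e(s,q)`.
(i) If `L` has an element of order `rs`, then for all distinct odd primes `r', s'` with
`e(r',q) = i` and `e(s',q) = j`, `L` has an element of order `r's'`.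
(ii) If `L` has an element of order `pr`, then for every odd prime `r'` with `e(r',q) = i`,
`L` has an element of order `pr'`. -/
theorem adjacency_transfer_in_PSL (F : Type*) [Field F] [Fintype F] (q p : ℕ)
    (hq : Fintype.card F = q) (hp : p.Prime) (hchar : CharP F p)
    (n : ℕ) (hn : 2 ≤ n) (r s : ℕ) (hr : r.Prime) (hs : s.Prime) (hrs : r ≠ s)
    (hrq : ¬ r ∣ q * (q ^ 2 - 1)) (hsq : ¬ s ∣ q * (q ^ 2 - 1))
    (i j : ℕ) (hi : orderOf (q : ZMod r) = i) (hj : orderOf (q : ZMod s) = j) :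
    ((∃ x : ProjectiveSpecialLinearGroup (Fin n) F, orderOf x = r * s) →
      ∀ r' s' : ℕ, r'.Prime → s'.Prime → Odd r' → Odd s' → r' ≠ s' →
        orderOf (q : ZMod r') = i → orderOf (q : ZMod s') = j →
        ∃ x : ProjectiveSpecialLinearGroup (Fin n) F, orderOf x = r' * s') ∧
    ((∃ x : ProjectiveSpecialLinearGroup (Fin n) F, orderOf x = p * r) →
      ∀ r' : ℕ, r'.Prime → Odd r' → orderOf (q : ZMod r') = i →
        ∃ x : ProjectiveSpecialLinearGroup (Fin n) F, orderOf x = p * r') := by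
  subst hq
  have hq2 : 2 ≤ Fintype.card F := Fintype.one_lt_card
  have hi3 : 3 ≤ i := hi ▸ VasilevAux.order_ge_three hr hq2 hrq
  have hj3 : 3 ≤ j := hj ▸ VasilevAux.order_ge_three hs hq2 hsq
  have hrq' : ¬ r ∣ Fintype.card F := fun h => hrq (h.mul_right _)
  have hsq' : ¬ s ∣ Fintype.card F := fun h => hsq (h.mul_right _)
  have hrc := VasilevAux.coprime_of_order hr hq2 (hi.symm ▸ hi3)
  have hsc := VasilevAux.coprime_of_order hs hq2 (hj.symm ▸ hj3)
  have hpq : p ∣ Fintype.card F :=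
    (CharP.cast_eq_zero_iff F p _).mp (FiniteField.cast_card_eq_zero F)
  have hpc : p.Coprime (Fintype.card F - 1) := by
    rw [hp.coprime_iff_not_dvd]
    intro h
    have h1 := (Nat.dvd_sub hpq h)
    rw [Nat.sub_sub_self (by omega)] at h1
    exact hp.one_lt.ne' (Nat.dvd_one.mp h1)
  constructor
  · intro hx r' s' hr' hs' _ _ hne hi' hj'
    have hrc' := VasilevAux.coprime_of_order hr' hq2 (hi'.symm ▸ hi3)
    have hsc' := VasilevAux.coprime_of_order hs' hq2 (hj'.symm ▸ hj3)
    rw [VasilevAux.psl_iff hn (Nat.mul_pos hr'.pos hs'.pos) (hrc'.mul_left hsc')]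
    rw [VasilevAux.psl_iff hn (Nat.mul_pos hr.pos hs.pos) (hrc.mul_left hsc)] at hx
    obtain ⟨f, hf⟩ := hx
    obtain ⟨t, u, htu, ht, hu, ht1, hu1⟩ := VasilevAux.split hr.one_lt hs.one_lt f hf
    have hcop : r'.Coprime s' := (Nat.coprime_primes hr' hs').mpr hne
    have hb := VasilevAux.rs_bound hr hs hrq' hsq' hi hj t u htu ht hu ht1 hu1
    rw [Module.finrank_fin_fun] at hb
    rcases hb with hb | hb
    · rw [← hcop.lcm_eq_mul]
      exact ((VasilevAux.HasOrd.singer p hp (k := i) (by omega)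
        (VasilevAux.dvd_of_order hq2 hi'.dvd)).add
        (VasilevAux.HasOrd.singer p hp (k := j) (by omega)
        (VasilevAux.dvd_of_order hq2 hj'.dvd))).mono hb
    · exact (VasilevAux.HasOrd.singer p hp (k := i.lcm j) (Nat.lcm_pos (by omega) (by omega))
        (hcop.mul_dvd_of_dvd_of_dvd
          (VasilevAux.dvd_of_order hq2 (hi'.symm ▸ Nat.dvd_lcm_left i j))
          (VasilevAux.dvd_of_order hq2 (hj'.symm ▸ Nat.dvd_lcm_right i j)))).mono hb
  · intro hx r' hr' _ hi'
    have hrc' := VasilevAux.coprime_of_order hr' hq2 (hi'.symm ▸ hi3)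
    rw [VasilevAux.psl_iff hn (Nat.mul_pos hp.pos hr'.pos) (hpc.mul_left hrc')]
    rw [VasilevAux.psl_iff hn (Nat.mul_pos hp.pos hr.pos) (hpc.mul_left hrc)] at hx
    obtain ⟨f, hf⟩ := hx
    obtain ⟨u, t, hut, hu, ht, hu1, ht1⟩ := VasilevAux.split hp.one_lt hr.one_lt f hf
    have hb := VasilevAux.pr_bound hr hp hrq' hi (by omega) t u hut.symm ht hu ht1 hu1
    rw [Module.finrank_fin_fun] at hb
    have hne : p ≠ r' := by
      rintro rfl
      have h0 : (Fintype.card F : ZMod p) = 0 := (ZMod.natCast_eq_zero_iff _ _).mpr hpq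
      haveI : Fact p.Prime := ⟨hp⟩
      rw [h0, orderOf_zero] at hi'
      omega
    have hcop : p.Coprime r' := (Nat.coprime_primes hp hr').mpr hne
    rw [← hcop.lcm_eq_mul]
    exact ((VasilevAux.HasOrd.unip p hp).add (VasilevAux.HasOrd.singer p hp (k := i) (by omega)
        (VasilevAux.dvd_of_order hq2 hi'.dvd))).mono (by omega)
end

section
/- Let m > 5 and n = 2^m, and let L = SL_n(F_2) (which equals the simple group L_n(2)). Then the automorphism group Aut(L) contains an element of order 2^{m+1}. (Aut(L) is generated by the inner automorphisms together with the graph automorphism g ↦ (g^T)^{-1}, and an element of order 2^{m+1} exists in the coset of the graph automorphism, even though L itself contains no element of order 2^{m+1}.) -/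
namespace AutOrder

open Matrix

/-- The Gram matrix: upper triangular all-ones block of size `N-1`, plus a `1`. -/
def A (N : ℕ) : Matrix (Fin N) (Fin N) (ZMod 2) := fun i j =>
  if i = j ∨ (i.val < j.val ∧ j.val + 1 < N) then 1 else 0

lemma det_A (N : ℕ) : (A N).det = 1 := by
  rw [Matrix.det_of_upperTriangular]
  · simp [A]
  · intro i j hij
    simp only [id] at hij
    have h1 : i ≠ j := ne_of_gt hij
    have h2 : ¬ i.val < j.val := not_lt.mpr (le_of_lt hij)
    simp [A, h1, h2]

def a (N : ℕ) : SpecialLinearGroup (Fin N) (ZMod 2) := ⟨A N, det_A N⟩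

/-- `x ↦ a x⁻ᵀ a⁻¹` -/
def graphAut {N : ℕ} (a : SpecialLinearGroup (Fin N) (ZMod 2)) :
    MulAut (SpecialLinearGroup (Fin N) (ZMod 2)) where
  toFun x := a * (x.transpose)⁻¹ * a⁻¹
  invFun x := ((a⁻¹ * x * a).transpose)⁻¹
  left_inv x := by
    have h : a⁻¹ * (a * (x.transpose)⁻¹ * a⁻¹) * a = (x.transpose)⁻¹ := by group
    simp only [h]
    rw [inv_eq_iff_mul_eq_one]
    apply Subtype.ext
    simp [← Matrix.adjugate_transpose, Matrix.adjugate_mul]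
  right_inv x := by
    have h : ∀ y : SpecialLinearGroup (Fin N) (ZMod 2),
        ((y.transpose)⁻¹.transpose)⁻¹ = y := by
      intro y
      rw [inv_eq_iff_mul_eq_one]
      apply Subtype.ext
      simp [← Matrix.adjugate_transpose, Matrix.adjugate_mul]
    simp only [h]
    group
  map_mul' x y := by
    have h : (x * y).transpose = y.transpose * x.transpose := by
      apply Subtype.ext
      simp [Matrix.transpose_mul]
    simp only [h]
    group

lemma graphAut_sq {N : ℕ} (a : SpecialLinearGroup (Fin N) (ZMod 2)) :
    graphAut a ^ 2 = MulAut.conj (a * (a.transpose)⁻¹) := by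
  ext1 x
  rw [pow_two, MulAut.mul_apply, MulAut.conj_apply]
  change a * ((a * (x.transpose)⁻¹ * a⁻¹).transpose)⁻¹ * a⁻¹ = _
  have h : (a * (x.transpose)⁻¹ * a⁻¹).transpose = (a.transpose)⁻¹ * x⁻¹ * a.transpose := by
    apply Subtype.ext
    simp [Matrix.transpose_mul, ← Matrix.adjugate_transpose, mul_assoc]
  rw [h]
  group

/-- The cosquare. -/
def c (N : ℕ) : SpecialLinearGroup (Fin N) (ZMod 2) := a N * ((a N).transpose)⁻¹

lemma c_mul (N : ℕ) : (c N : Matrix (Fin N) (Fin N) (ZMod 2)) * (A N)ᵀ = A N := by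
  have h : c N * (a N).transpose = a N := by simp [c]
  have := congrArg Subtype.val h
  exact this

lemma c_row (N : ℕ) (v : Fin N → ZMod 2) : (c N).1 *ᵥ ((A N)ᵀ *ᵥ v) = A N *ᵥ v := by
  rw [Matrix.mulVec_mulVec, c_mul]

lemma c_col (N : ℕ) (j : Fin N) :
    (c N).1 *ᵥ (fun i => A N j i) = fun i => A N i j := by
  have := c_row N (Pi.single j 1)
  rw [Matrix.mulVec_single_one, Matrix.mulVec_single_one] at this
  exact this

/-- The cyclically permuted vectors. -/
def p (N : ℕ) (k : ℕ) : Fin N → ZMod 2 := fun i =>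
  if k + 1 < N then (if i.val = k then 1 else 0) else (if i.val + 1 < N then 1 else 0)

lemma c_p (N k : ℕ) (hk : k + 1 < N) : (c N).1 *ᵥ p N k = p N (k + 1) := by
  by_cases h2 : k + 2 < N
  · have h : p N k = (fun i => A N ⟨k, by omega⟩ i) + (fun i => A N ⟨k+1, by omega⟩ i) := by
      ext i
      simp only [p, A, Pi.add_apply, Fin.ext_iff]
      have : (1 : ZMod 2) + 1 = 0 := by decide
      split_ifs <;> first | omega | simp [this]
    rw [h, Matrix.mulVec_add, c_col, c_col]
    ext i
    simp only [p, A, Pi.add_apply, Fin.ext_iff]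
    have : (1 : ZMod 2) + 1 = 0 := by decide
    split_ifs <;> first | omega | simp [this]
  · have h : p N k = (fun i => A N ⟨k, by omega⟩ i) := by
      ext i
      simp only [p, A, Fin.ext_iff]
      split_ifs <;> first | omega | simp
    rw [h, c_col]
    ext i
    simp only [p, A, Fin.ext_iff]
    split_ifs <;> first | omega | simp

lemma c_p_last (N : ℕ) (hN : 2 ≤ N) : (c N).1 *ᵥ p N (N - 1) = p N 0 := by
  have h : p N (N - 1) = (fun i => A N ⟨0, by omega⟩ i) := by
    ext i
    simp only [p, A, Fin.ext_iff]
    split_ifs <;> first | omega | simp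
  rw [h, c_col]
  ext i
  simp only [p, A, Fin.ext_iff]
  split_ifs <;> first | omega | simp

lemma c_pow_p (N k : ℕ) (hk : k < N) : (c N).1 ^ k *ᵥ p N 0 = p N k := by
  induction k with
  | zero => simp
  | succ k ih =>
    rw [pow_succ', ← Matrix.mulVec_mulVec, ih (by omega), c_p N k hk]

lemma c_pow_N_p (N k : ℕ) (hN : 2 ≤ N) (hk : k < N) : (c N).1 ^ N *ᵥ p N k = p N k := by
  have h0 : (c N).1 ^ N *ᵥ p N 0 = p N 0 := by
    obtain ⟨M, rfl⟩ : ∃ M, N = M + 1 := ⟨N - 1, by omega⟩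
    rw [pow_succ', ← Matrix.mulVec_mulVec, c_pow_p _ M (by omega)]
    exact c_p_last (M + 1) hN
  rw [← c_pow_p N k hk, Matrix.mulVec_mulVec, ← pow_add, add_comm, pow_add,
    ← Matrix.mulVec_mulVec, h0]

lemma c_fix (N : ℕ) (k : ℕ) (j : Fin N) (hj : j.val + 1 = N) :
    (c N).1 ^ k *ᵥ Pi.single j 1 = Pi.single j 1 := by
  induction k with
  | zero => rw [pow_zero, Matrix.one_mulVec]
  | succ k ih =>
    rw [pow_succ', ← Matrix.mulVec_mulVec, ih]
    have h : (Pi.single j 1 : Fin N → ZMod 2) = fun i => A N j i := by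
      ext i
      simp only [A, Pi.single_apply, Fin.ext_iff]
      split_ifs <;> first | omega | simp
    rw [h, c_col]
    ext i
    simp only [A, Fin.ext_iff]
    split_ifs <;> first | omega | simp

lemma c_pow_N (N : ℕ) (hN : 2 ≤ N) : c N ^ N = 1 := by
  apply Subtype.ext
  change (c N).1 ^ N = 1
  apply Matrix.ext_of_mulVec_single
  intro j
  rw [Matrix.one_mulVec]
  by_cases hj : j.val + 1 < N
  · have h : (Pi.single j 1 : Fin N → ZMod 2) = p N j := by
      ext i
      simp [p, hj, Pi.single_apply, Fin.ext_iff]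
    rw [h]
    exact c_pow_N_p N j hN j.2
  · exact c_fix N N j (by omega)

lemma conj_c_pow (N k : ℕ) (hk : 0 < k) (hkN : k + 1 < N) : MulAut.conj (c N ^ k) ≠ 1 := by
  intro h
  have hc : c N ^ k ∈ Subgroup.center (SpecialLinearGroup (Fin N) (ZMod 2)) := by
    rw [Subgroup.mem_center_iff]
    intro g
    have := DFunLike.congr_fun h g
    rw [MulAut.conj_apply, MulAut.one_apply, mul_inv_eq_iff_eq_mul] at this
    exact this.symm
  rw [Matrix.SpecialLinearGroup.mem_center_iff] at hc
  obtain ⟨r, -, hr⟩ := hc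
  have h1 := c_pow_p N k (by omega)
  rw [Matrix.SpecialLinearGroup.coe_pow] at hr
  rw [← hr] at h1
  have h2 := congrFun h1 ⟨k, by omega⟩
  have hk0 : k ≠ 0 := by omega
  have h01 : 1 < N := by omega
  simp [p, Matrix.scalar_apply, Matrix.mulVec_diagonal, hk0, hkN, h01] at h2

end AutOrder

/-- Let `m > 5`, `n = 2^m`, and `L = SL_n(F₂) = L_n(2)`.  Then the
automorphism group `Aut(L)` contains an element of order `2^(m+1)`. -/
theorem aut_has_element_of_order (m : ℕ) (hm : 5 < m) :
    ∃ f : MulAut (Matrix.SpecialLinearGroup (Fin (2 ^ m)) (ZMod 2)),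
      orderOf f = 2 ^ (m + 1) := by
  refine ⟨AutOrder.graphAut (AutOrder.a (2 ^ m)), ?_⟩
  have hsq : AutOrder.graphAut (AutOrder.a (2 ^ m)) ^ 2 = MulAut.conj (AutOrder.c (2 ^ m)) :=
    AutOrder.graphAut_sq _
  have h4 : 2 ^ 2 ≤ 2 ^ m := Nat.pow_le_pow_right (by norm_num) (by omega)
  apply orderOf_eq_prime_pow
  · obtain ⟨l, rfl⟩ : ∃ l, m = l + 1 := ⟨m - 1, by omega⟩
    have hp : 2 ^ (l + 1) = 2 * 2 ^ l := pow_succ' 2 l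
    have h := AutOrder.conj_c_pow (2 ^ (l + 1)) (2 ^ l) (by positivity) (by omega)
    intro hf
    apply h
    rw [map_pow, ← hsq, ← pow_mul, ← pow_succ']
    exact hf
  · rw [pow_succ', pow_mul, hsq, ← map_pow, AutOrder.c_pow_N _ (by omega), map_one]
end
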